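/- Suppose |S| = q + 2 (so t = k − 3) and let m ≤ n be integers with n ≥ k − p. Let A (of size n − m), L (of size k − 1 − m), Ω (of size k − 2 − n), X = (x_1, …, x_m) and Y = (y_1, …, y_m) be pairwise disjoint ordered subsequences of S, and set M = {1, …, m}. Then 0 = ∑_{B ⊆ L, |B| = n − m} ∑_{τ ⊆ M} (−1)^{σ(B,L) + σ(X_τ, X) + |τ|} P_{(L \ B) ∪ X_{M \ τ}}(A ⌢ Y_τ, B ⌢ X_τ) ∏_{z ∈ Ω ∪ B ∪ X_τ ∪ Y_{M \ τ}} det(z, A, X_{M \ τ}, Y_τ, L \ B)^{−1}, where X_τ = (x_i : i ∈ τ) and Y_τ = (y_i : i ∈ τ) with indices in increasing order, and ⌢ denotes concatenation of sequences. -/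

import Mathlib

/-- `detCols L` is the determinant of the `k × k` matrix whose `j`-th column is the
`j`-th entry of the list `L` (lists of length ≠ `k` are padded with `0`). -/
def detCols {F : Type} [CommRing F] {k : ℕ} (L : List (Fin k → F)) : F :=
  Matrix.det (Matrix.of fun i j : Fin k => L.getD (j : ℕ) 0 i)

/-- The Segre product `P_D(A, B)` of the sequences `A = (a_1, …, a_n)` and
`B = (b_0, …, b_{n−1})` with base `D`, with respect to the family of tangent functions `T`:
`∏_{i=1}^n T_{D ∪ {a_1,…,a_{i−1},b_i,…,b_{n−1}}}(a_i) ·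
  T_{D ∪ {a_1,…,a_{i−1},b_i,…,b_{n−1}}}(b_{i−1})⁻¹`. -/
def segreP {F : Type} [Field F] [DecidableEq F] {k : ℕ}
    (T : Finset (Fin k → F) → (Fin k → F) → F)
    (D : Finset (Fin k → F)) (A B : List (Fin k → F)) : F :=
  ∏ j ∈ Finset.range A.length,
    (T (D ∪ (A.take j).toFinset ∪ (B.drop (j + 1)).toFinset) (A.getD j 0) *
      (T (D ∪ (A.take j).toFinset ∪ (B.drop (j + 1)).toFinset) (B.getD j 0))⁻¹)

/-- `T` is a family of tangent functions for `S` (with `t` tangent hyperplanes through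
each subset of size `k − 2`): for every `Y ⊆ S` with `|Y| = k − 2` there is a set `Φ` of
`t` pairwise linearly independent linear forms, each vanishing on `Y` and nonzero at every
vector of `S \ Y`, with `T Y = ∏_{α ∈ Φ} α`. -/
def IsTangentFamily {F : Type} [Field F] [DecidableEq F] {k : ℕ} (t : ℕ)
    (S : Finset (Fin k → F)) (T : Finset (Fin k → F) → (Fin k → F) → F) : Prop :=
  ∀ Y : Finset (Fin k → F), Y ⊆ S → Y.card = k - 2 →
    ∃ Φ : Finset ((Fin k → F) →ₗ[F] F),
      Φ.card = t ∧
      (∀ α ∈ Φ, ∀ β ∈ Φ, α ≠ β → ∀ c : F, α ≠ c • β) ∧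
      (∀ α ∈ Φ, ∀ y ∈ Y, α y = 0) ∧
      (∀ α ∈ Φ, ∀ s ∈ S, s ∉ Y → α s ≠ 0) ∧
      (∀ x, T Y x = ∏ α ∈ Φ, α x)

/-- The subsequence of `L` consisting of the entries whose positions lie in `s`,
in their original order (`d` is a default value). -/
def subseq {α : Type} (d : α) (L : List α) (s : Finset ℕ) : List α :=
  ((List.range L.length).filter (fun i => decide (i ∈ s))).map (fun i => L.getD i d)

/-- The subsequence of `L` consisting of the entries whose positions do not lie in `s`,
in their original order (`d` is a default value). -/
def subseqC {α : Type} (d : α) (L : List α) (s : Finset ℕ) : List α :=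
  ((List.range L.length).filter (fun i => decide (i ∉ s))).map (fun i => L.getD i d)

/-- The number of transpositions needed (counted as the number of inversions) to reorder a
list of length `len` so that the entries in positions `s` occupy the last `|s|` positions,
preserving the relative order of the two groups. -/
def invCount (s : Finset ℕ) (len : ℕ) : ℕ :=
  ((Finset.range len ×ˢ Finset.range len).filter
    (fun ij => ij.1 ∈ s ∧ ij.2 ∉ s ∧ ij.1 < ij.2)).card

/-- If the sums of `G` over the `r`-sets containing a given `(r - 1)`-set vanish, then so do the
sums over the `r`-sets containing a smaller set, as long as the multiplicities are invertible. -/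
lemma sum_supersets_eq_zero {α F : Type*} [DecidableEq α] [Field F] (U : Finset α)
    (G : Finset α → F) (r n : ℕ)
    (hG : ∀ Y ⊆ U, Y.card + 1 = r → ∑ a ∈ U \ Y, G (insert a Y) = 0)
    (hinv : ∀ j : ℕ, 1 ≤ j → j + n ≤ r → (j : F) ≠ 0) (d : ℕ) :
    ∀ V ⊆ U, n ≤ V.card → V.card + d + 1 = r →
      ∑ C ∈ U.powersetCard r, (if V ⊆ C then G C else 0) = 0 := by
  induction d with
  | zero =>
    intro V hV _ hr
    rw [← Finset.sum_filter, ← hG V hV hr]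
    symm
    refine Finset.sum_bij (fun a _ => insert a V) ?_ ?_ ?_ (fun _ _ => rfl)
    · intro a ha
      rw [Finset.mem_sdiff] at ha
      simp only [Finset.mem_filter, Finset.mem_powersetCard]
      refine ⟨⟨Finset.insert_subset ha.1 hV, ?_⟩, Finset.subset_insert _ _⟩
      rw [Finset.card_insert_of_notMem ha.2]; omega
    · intro a ha b hb hab
      rw [Finset.mem_sdiff] at ha hb
      have : a ∈ insert b V := hab ▸ Finset.mem_insert_self a V
      exact (Finset.mem_insert.1 this).resolve_right ha.2
    · intro C hC
      simp only [Finset.mem_filter, Finset.mem_powersetCard] at hC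
      obtain ⟨a, ha, rfl⟩ := (Finset.covBy_iff_exists_insert.1
        (Finset.covBy_iff_card_sdiff_eq_one.2 ⟨hC.2, by
          rw [Finset.card_sdiff_of_subset hC.2]; omega⟩))
      exact ⟨a, Finset.mem_sdiff.2 ⟨hC.1.1 (Finset.mem_insert_self _ _), ha⟩, rfl⟩
  | succ d ih =>
    intro V hV hn hr
    have key : ∑ a ∈ U \ V, ∑ C ∈ U.powersetCard r, (if insert a V ⊆ C then G C else 0) =
        ((d + 2 : ℕ) : F) * ∑ C ∈ U.powersetCard r, (if V ⊆ C then G C else 0) := by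
      rw [Finset.sum_comm, Finset.mul_sum]
      refine Finset.sum_congr rfl fun C hC => ?_
      rw [Finset.mem_powersetCard] at hC
      by_cases hVC : V ⊆ C
      · have h1 : ∀ a, insert a V ⊆ C ↔ a ∈ C := fun a => by
          simp [Finset.insert_subset_iff, hVC]
        simp only [h1, hVC, if_true]
        rw [← Finset.sum_filter, Finset.sum_const, nsmul_eq_mul]
        have h2 : (U \ V).filter (· ∈ C) = C \ V := by
          ext a
          simp only [Finset.mem_filter, Finset.mem_sdiff]
          exact ⟨fun h => ⟨h.2, h.1.2⟩, fun h => ⟨⟨hC.1 h.1, h.2⟩, h.1⟩⟩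
        rw [h2, Finset.card_sdiff_of_subset hVC, show C.card - V.card = d + 2 by omega]
      · simp [Finset.insert_subset_iff, hVC]
    rw [Finset.sum_eq_zero] at key
    · exact (mul_eq_zero.1 key.symm).resolve_left (hinv _ (by omega) (by omega))
    · intro a ha
      rw [Finset.mem_sdiff] at ha
      have hc := Finset.card_insert_of_notMem ha.2
      exact ih _ (Finset.insert_subset ha.1 hV) (by omega) (by omega)

/-- The vanishing sums over supersets, twisted by exclusions and by differences of indicators. -/
lemma sum_indicator_eq_zero {α ι F : Type*} [DecidableEq α] [DecidableEq ι] [Field F]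
    (U : Finset α)
    (G : Finset α → F) (r n : ℕ)
    (hG : ∀ Y ⊆ U, Y.card + 1 = r → ∑ a ∈ U \ Y, G (insert a Y) = 0)
    (hinv : ∀ j : ℕ, 1 ≤ j → j + n ≤ r → (j : F) ≠ 0) (x y : ι → α) (M : Finset ι) :
    (∀ i ∈ M, ∀ j ∈ M, i ≠ j → x i ≠ x j ∧ y i ≠ y j ∧ x i ≠ y j) →
    (∀ i ∈ M, x i ∈ U ∧ y i ∈ U) →
    ∀ (W V : Finset α), V ⊆ U → W ⊆ U → Disjoint V W →
      (∀ i ∈ M, x i ∉ V ∧ y i ∉ V ∧ x i ∉ W ∧ y i ∉ W) →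
      n ≤ V.card + M.card → V.card + W.card + M.card + 1 ≤ r →
      ∑ C ∈ U.powersetCard r, G C * ((if V ⊆ C then 1 else 0) * (if Disjoint W C then 1 else 0) *
        ∏ i ∈ M, ((if x i ∈ C then 1 else 0) - (if y i ∈ C then 1 else 0))) = 0 := by
  induction M using Finset.induction_on with
  | empty =>
    intro _ _ W
    induction W using Finset.induction_on with
    | empty =>
      intro V hV _ _ _ hn hr
      have := sum_supersets_eq_zero U G r n hG hinv (r - V.card - 1) V hV (by simpa using hn)
        (by simp at hr; omega)
      simpa using this
    | insert w W hw ih =>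
      intro V hV hW hVW _ hn hr
      rw [Finset.disjoint_insert_right] at hVW
      rw [Finset.insert_subset_iff] at hW
      have hc := Finset.card_insert_of_notMem hw
      have hc' := Finset.card_insert_of_notMem hVW.1
      have h1 := ih V hV hW.2 hVW.2 (by simp) hn (by omega)
      have h2 := ih (insert w V) (Finset.insert_subset hW.1 hV) hW.2
        (Finset.disjoint_insert_left.2 ⟨hw, hVW.2⟩) (by simp) (by omega) (by omega)
      refine Eq.trans ?_ (sub_eq_zero.2 (h1.trans h2.symm))
      rw [← Finset.sum_sub_distrib]
      refine Finset.sum_congr rfl fun C _ => ?_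
      rw [← mul_sub]
      congr 1
      simp only [Finset.disjoint_insert_left, Finset.insert_subset_iff]
      by_cases hwC : w ∈ C <;> by_cases hVC : V ⊆ C <;> by_cases hWC : Disjoint W C <;>
        simp [hwC, hVC, hWC]
  | insert i M hi ih =>
    intro hxy hU W V hV hW hVW hVWM hn hr
    have hc := Finset.card_insert_of_notMem hi
    have hii := Finset.mem_insert_self i M
    have hM : ∀ {j}, j ∈ M → j ∈ insert i M := fun h => Finset.mem_insert_of_mem h
    have hne : ∀ {j}, j ∈ M → i ≠ j := fun h e => hi (e ▸ h)
    obtain ⟨hx1, hy1, hx2, hy2⟩ := hVWM i hii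
    have ih' := ih (fun i hi j hj => hxy i (hM hi) j (hM hj)) (fun i hi => hU i (hM hi)) W
    have hcx := Finset.card_insert_of_notMem hx1
    have hcy := Finset.card_insert_of_notMem hy1
    have h1 := ih' (insert (x i) V) (Finset.insert_subset (hU i hii).1 hV) hW
      (Finset.disjoint_insert_left.2 ⟨hx2, hVW⟩) (fun j hj => by
        obtain ⟨a, b, c, d⟩ := hVWM j (hM hj)
        have e1 := hxy i hii j (hM hj) (hne hj)
        simp only [Finset.mem_insert, not_or]
        exact ⟨⟨e1.1.symm, a⟩, ⟨e1.2.2.symm, b⟩, c, d⟩) (by omega) (by omega)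
    have h2 := ih' (insert (y i) V) (Finset.insert_subset (hU i hii).2 hV) hW
      (Finset.disjoint_insert_left.2 ⟨hy2, hVW⟩) (fun j hj => by
        obtain ⟨a, b, c, d⟩ := hVWM j (hM hj)
        have e1 := hxy i hii j (hM hj) (hne hj)
        have e2 := hxy j (hM hj) i hii (hne hj).symm
        simp only [Finset.mem_insert, not_or]
        exact ⟨⟨e2.2.2, a⟩, ⟨e1.2.1.symm, b⟩, c, d⟩) (by omega) (by omega)
    refine Eq.trans ?_ (sub_eq_zero.2 (h1.trans h2.symm))
    rw [← Finset.sum_sub_distrib]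
    refine Finset.sum_congr rfl fun C _ => ?_
    rw [← mul_sub, Finset.prod_insert hi]
    congr 1
    simp only [Finset.insert_subset_iff]
    by_cases hxC : x i ∈ C <;> by_cases hyC : y i ∈ C <;> by_cases hVC : V ⊆ C <;>
      simp [hxC, hyC, hVC]

set_option maxHeartbeats 2000000 in
/-- Tangent-type data satisfying the cyclic three-term relation can be rescaled to a symmetric
function. -/
lemma exists_symmetric_scaling {α F : Type*} [DecidableEq α] [Field F] (r : ℕ) :
    ∀ (V : Finset α) (h : Finset α → α → F),
      (∀ Y ⊆ V, Y.card = r → ∀ x ∈ V, x ∉ Y → h Y x ≠ 0) →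
      (∀ D ⊆ V, D.card + 1 = r → ∀ x ∈ V, ∀ y ∈ V, ∀ z ∈ V, x ∉ D → y ∉ D → z ∉ D →
        x ≠ y → y ≠ z → z ≠ x →
        h (insert x D) y * h (insert y D) z * h (insert z D) x =
          h (insert y D) x * h (insert z D) y * h (insert x D) z) →
      ∃ c : Finset α → F, (∀ Y ⊆ V, Y.card = r → c Y ≠ 0) ∧
        ∀ D ⊆ V, D.card + 1 = r → ∀ x ∈ V, ∀ y ∈ V, x ∉ D → y ∉ D → x ≠ y →
          c (insert x D) * h (insert x D) y = c (insert y D) * h (insert y D) x := by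
  induction r with
  | zero => exact fun V h _ _ => ⟨fun _ => 1, fun _ _ _ => one_ne_zero, fun D _ h => by omega⟩
  | succ r ih =>
    intro V h hne htri
    rcases V.eq_empty_or_nonempty with rfl | ⟨v, hv⟩
    · exact ⟨fun _ => 1, fun _ _ _ => one_ne_zero, fun D _ _ x hx => by simp at hx⟩
    obtain ⟨c, hc, hcs⟩ := ih (V.erase v) (fun Y x => h (insert v Y) x)
      (fun Y hY hYr x hx hxY => hne _ (by clear ih hne htri; grind) (by clear ih hne htri; grind) x
          (by clear ih hne htri; grind) (by clear ih hne htri; grind))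
      (fun D hD hDr x hx y hy z hz hxD hyD hzD hxy hyz hzx => by
        simp only [Finset.insert_comm v]
        exact htri _ (by clear ih hne htri; grind) (by clear ih hne htri; grind) x
            (by clear ih hne htri; grind) y (by clear ih hne htri; grind) z
            (by clear ih hne htri; grind) (by clear ih hne htri; grind)
          (by clear ih hne htri; grind) (by clear ih hne htri; grind) hxy hyz hzx)
    have hq : ∀ Y : Finset α, ∃ b : F, (Y ⊆ V → Y.card = r + 1 → v ∉ Y → b ≠ 0 ∧
        ∀ y ∈ Y, b * h Y v = c (Y.erase y) * h (insert v (Y.erase y)) y) := by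
      intro Y
      by_cases hY : Y ⊆ V ∧ Y.card = r + 1 ∧ v ∉ Y
      · obtain ⟨hYV, hYr, hvY⟩ := hY
        obtain ⟨y, hy⟩ : Y.Nonempty := Finset.card_pos.1 (by omega)
        have h0 := hne Y hYV hYr v hv hvY
        have h1 : ∀ y ∈ Y, h (insert v (Y.erase y)) y ≠ 0 := fun y hy =>
          hne _ (by clear ih hne htri hcs hc; grind) (by clear ih hne htri hcs hc; grind) y (hYV hy)
              (by clear ih hne htri hcs hc; grind)
        refine ⟨c (Y.erase y) * h (insert v (Y.erase y)) y / h Y v, fun _ _ _ =>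
          ⟨div_ne_zero (mul_ne_zero (hc _ (by clear ih hne htri hcs hc; grind)
              (by clear ih hne htri hcs hc; grind)) (h1 y hy)) h0,
            fun z hz => ?_⟩⟩
        rw [div_mul_cancel₀ _ h0]
        rcases eq_or_ne y z with rfl | hyz
        · rfl
        have := hcs ((Y.erase y).erase z) (by clear ih hne htri hcs hc; grind)
            (by clear ih hne htri hcs hc; grind) z (by clear ih hne htri hcs hc; grind) y
            (by clear ih hne htri hcs hc; grind)
          (by clear ih hne htri hcs hc; grind) (by clear ih hne htri hcs hc; grind) hyz.symm
        have e1 : insert z ((Y.erase y).erase z) = Y.erase y :=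
          Finset.insert_erase (Finset.mem_erase.2 ⟨hyz.symm, hz⟩)
        have e2 : insert y ((Y.erase y).erase z) = Y.erase z := by
          rw [Finset.erase_right_comm, Finset.insert_erase (Finset.mem_erase.2 ⟨hyz, hy⟩)]
        rwa [e1, e2] at this
      · exact ⟨0, fun a b c => absurd ⟨a, b, c⟩ hY⟩
    choose b hb using hq
    have hbi : ∀ D ⊆ V, D.card = r → v ∉ D → ∀ x ∈ V, x ∉ D → x ≠ v →
        b (insert x D) * h (insert x D) v = c D * h (insert v D) x := by
      intro D hD hDr hvD x hx hxD hxv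
      have := (hb (insert x D) (by clear ih hne htri hcs hc hb; grind)
          (by clear ih hne htri hcs hc hb; grind) (by clear ih hne htri hcs hc hb; grind)).2 x
          (by clear ih hne htri hcs hc hb; grind)
      rwa [Finset.erase_insert hxD] at this
    refine ⟨fun Y => if v ∈ Y then c (Y.erase v) else b Y, fun Y hY hYr => ?_, ?_⟩
    · by_cases hvY : v ∈ Y
      · simp only [hvY, if_true]
        exact hc _ (by clear ih hne htri hcs hc hb hbi; grind)
            (by clear ih hne htri hcs hc hb hbi; grind)
      · simp only [hvY, if_false]
        exact (hb Y hY hYr hvY).1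
    intro D hD hDr x hx y hy hxD hyD hxy
    by_cases hvD : v ∈ D
    · have := hcs (D.erase v) (Finset.erase_subset_erase v hD)
        (by have := Finset.card_erase_add_one hvD; omega) x
            (by clear ih hne htri hcs hc hb hbi; grind) y
            (by clear ih hne htri hcs hc hb hbi; grind) (by clear ih hne htri hcs hc hb hbi; grind)
        (by clear ih hne htri hcs hc hb hbi; grind) hxy
      have ex : (insert x D).erase v = insert x (D.erase v) :=
        Finset.erase_insert_of_ne (ne_of_mem_of_not_mem hvD hxD).symm
      have ey : (insert y D).erase v = insert y (D.erase v) :=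
        Finset.erase_insert_of_ne (ne_of_mem_of_not_mem hvD hyD).symm
      have ex' : insert v (insert x (D.erase v)) = insert x D := by
        rw [Finset.insert_comm, Finset.insert_erase hvD]
      have ey' : insert v (insert y (D.erase v)) = insert y D := by
        rw [Finset.insert_comm, Finset.insert_erase hvD]
      simp only [ex', ey'] at this
      simpa only [Finset.mem_insert, hvD, or_true, if_true, ex, ey] using this
    · rcases eq_or_ne x v with rfl | hxv
      · have := hbi D hD (by omega) hvD y hy hyD hxy.symm
        simp only [Finset.mem_insert_self, if_true, Finset.erase_insert hxD]
        rw [if_neg (by simp [hxy, hxD])]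
        exact this.symm
      rcases eq_or_ne y v with rfl | hyv
      · have := hbi D hD (by omega) hvD x hx hxD hxy
        simp only [Finset.mem_insert_self, if_true, Finset.erase_insert hyD]
        rw [if_neg (by simp [hxy.symm, hyD])]
        exact this
      have h1 := hbi D hD (by omega) hvD x hx hxD hxv
      have h2 := hbi D hD (by omega) hvD y hy hyD hyv
      have h3 := htri D hD hDr v hv x hx y hy hvD hxD hyD hxv.symm hxy hyv
      have n1 := hne (insert x D) (by clear ih hne htri hcs hc hb hbi; grind)
          (by clear ih hne htri hcs hc hb hbi; grind) v hv
          (by clear ih hne htri hcs hc hb hbi; grind)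
      have n2 := hne (insert y D) (by clear ih hne htri hcs hc hb hbi; grind)
          (by clear ih hne htri hcs hc hb hbi; grind) v hv
          (by clear ih hne htri hcs hc hb hbi; grind)
      have nx : v ∉ insert x D := by simp [hvD, hxv.symm]
      have ny : v ∉ insert y D := by simp [hvD, hyv.symm]
      simp only [nx, ny, if_false]
      apply mul_right_cancel₀ (mul_ne_zero n1 n2)
      linear_combination (h (insert x D) y * h (insert y D) v) * h1 -
        (h (insert y D) x * h (insert x D) v) * h2 + c D * h3

/-- A function on lists is `ε`-alternating if swapping two adjacent entries multiplies it
by `ε`. -/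
def IsAlternating {α F : Type*} [Mul F] (ε : F) (f : List α → F) : Prop :=
  ∀ u a b v, f (u ++ a :: b :: v) = ε * f (u ++ b :: a :: v)

lemma IsAlternating.move {α F : Type*} [Field F] {ε : F} {f : List α → F}
    (hf : IsAlternating ε f) (a : α) (v w : List α) :
    ∀ u, f (u ++ a :: (v ++ w)) = ε ^ v.length * f (u ++ v ++ a :: w) := by
  induction v with
  | nil => simp
  | cons b v ih =>
    intro u
    have h := ih (u ++ [b])
    simp only [List.append_assoc, List.cons_append, List.nil_append] at h ⊢
    rw [hf, h, List.length_cons, pow_succ', mul_assoc]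

lemma IsAlternating.swap_blocks {α F : Type*} [Field F] {ε : F} {f : List α → F}
    (hf : IsAlternating ε f) (v w x : List α) :
    ∀ u, f (u ++ (v ++ (w ++ x))) = ε ^ (v.length * w.length) * f (u ++ (w ++ (v ++ x))) := by
  induction v with
  | nil => simp
  | cons b v ih =>
    intro u
    have h := ih (u ++ [b])
    have h2 := hf.move b w (v ++ x) u
    simp only [List.append_assoc, List.cons_append, List.nil_append] at h h2 ⊢
    rw [h, h2, List.length_cons]
    ring

lemma subseq_concat {α : Type} (d : α) (L : List α) (a : α) (s : Finset ℕ) :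
    subseq d (L ++ [a]) s = subseq d L s ++ if L.length ∈ s then [a] else [] := by
  unfold subseq
  rw [List.length_append, List.length_singleton, List.range_succ, List.filter_append,
    List.map_append]
  congr 1
  · refine List.map_congr_left fun i hi => ?_
    have : i < L.length := List.mem_range.1 (List.mem_filter.1 hi).1
    simp [List.getD_eq_getElem?_getD, List.getElem?_append_left this]
  · by_cases h : L.length ∈ s <;> simp [h]

lemma subseqC_concat {α : Type} (d : α) (L : List α) (a : α) (s : Finset ℕ) :
    subseqC d (L ++ [a]) s = subseqC d L s ++ if L.length ∈ s then [] else [a] := by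
  unfold subseqC
  rw [List.length_append, List.length_singleton, List.range_succ, List.filter_append,
    List.map_append]
  congr 1
  · refine List.map_congr_left fun i hi => ?_
    have : i < L.length := List.mem_range.1 (List.mem_filter.1 hi).1
    simp [List.getD_eq_getElem?_getD, List.getElem?_append_left this]
  · by_cases h : L.length ∈ s <;> simp [h]

lemma length_subseq {α : Type} (d : α) (L : List α) (s : Finset ℕ) :
    (subseq d L s).length = ((Finset.range L.length).filter (· ∈ s)).card := by
  induction L using List.reverseRecOn with
  | nil => simp [subseq]
  | append_singleton L a ih =>
    rw [subseq_concat, List.length_append, ih, List.length_append, List.length_singleton,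
      Finset.range_add_one, Finset.filter_insert]
    split_ifs <;> simp

lemma invCount_succ (s : Finset ℕ) (n : ℕ) :
    invCount s (n + 1) =
      invCount s n + if n ∈ s then 0 else ((Finset.range n).filter (· ∈ s)).card := by
  unfold invCount
  rw [show ((Finset.range (n + 1) ×ˢ Finset.range (n + 1)).filter
      (fun ij => ij.1 ∈ s ∧ ij.2 ∉ s ∧ ij.1 < ij.2)) =
      ((Finset.range n ×ˢ Finset.range n).filter
        (fun ij => ij.1 ∈ s ∧ ij.2 ∉ s ∧ ij.1 < ij.2)) ∪
      (if n ∈ s then ∅ else ((Finset.range n).filter (· ∈ s)).image fun i => (i, n)) by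
    ext ⟨i, j⟩
    by_cases h : n ∈ s
    · simp only [Finset.mem_filter, Finset.mem_product, Finset.mem_range, h, if_true,
        Finset.union_empty]
      grind
    · simp only [Finset.mem_filter, Finset.mem_product, Finset.mem_range, h, if_false,
        Finset.mem_union, Finset.mem_image, Prod.mk.injEq]
      grind]
  rw [Finset.card_union_of_disjoint]
  · split_ifs
    · rfl
    · rw [Finset.card_image_of_injective _ fun _ _ h => (Prod.mk.inj h).1]
  · rw [Finset.disjoint_left]
    rintro ⟨i, j⟩ h1 h2
    split_ifs at h2
    · simp at h2
    · simp at h1 h2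
      omega

lemma IsAlternating.subseq_move {α : Type} {F : Type*} [Field F] {ε : F} {f : List α → F}
    (hf : IsAlternating ε f) (d : α) (u : List α) (s : Finset ℕ) (L : List α) :
    ∀ w, f (u ++ (subseqC d L s ++ (subseq d L s ++ w))) =
      ε ^ invCount s L.length * f (u ++ (L ++ w)) := by
  induction L using List.reverseRecOn with
  | nil => simp [subseq, subseqC, invCount]
  | append_singleton L a ih =>
    intro w
    rw [subseq_concat, subseqC_concat, List.length_append, List.length_singleton, invCount_succ]
    have h := ih (a :: w)
    by_cases ha : L.length ∈ s
    · simpa [ha] using h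
    · have h2 := hf.move a (subseq d L s) w (u ++ subseqC d L s)
      simp only [ha, if_false, List.append_assoc, List.append_nil, List.cons_append,
        List.nil_append] at h h2 ⊢
      rw [h2, h, length_subseq, pow_add]
      ring

lemma mem_subseq {α : Type} {d a : α} {L : List α} {s : Finset ℕ} :
    a ∈ subseq d L s ↔ ∃ i < L.length, i ∈ s ∧ L.getD i d = a := by
  simp [subseq, and_assoc]

lemma mem_subseqC {α : Type} {d a : α} {L : List α} {s : Finset ℕ} :
    a ∈ subseqC d L s ↔ ∃ i < L.length, i ∉ s ∧ L.getD i d = a := by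
  simp [subseqC, and_assoc]

lemma subseqC_append_subseq_perm {α : Type} (d : α) (L : List α) (s : Finset ℕ) :
    (subseqC d L s ++ subseq d L s).Perm L := by
  induction L using List.reverseRecOn with
  | nil => simp [subseq, subseqC]
  | append_singleton L a ih =>
    rw [subseq_concat, subseqC_concat]
    split_ifs
    · simpa [← List.append_assoc] using ih.append_right [a]
    · simp only [List.append_nil, List.append_assoc]
      refine (List.Perm.append_left _ List.perm_append_comm).trans ?_
      rw [← List.append_assoc]
      exact ih.append_right [a]

/-- The number of inversions of a list with respect to a rank function. -/
def inversions {α : Type*} (e : α → ℕ) : List α → ℕ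
  | [] => 0
  | a :: l => l.countP (fun b => decide (e b < e a)) + inversions e l

lemma inversions_swap {α : Type*} (e : α → ℕ) (u : List α) (a b : α) (v : List α)
    (h : e a < e b) :
    inversions e (u ++ b :: a :: v) = inversions e (u ++ a :: b :: v) + 1 := by
  induction u with
  | nil =>
    have h' : ¬ e b < e a := by omega
    simp only [List.nil_append, inversions, List.countP_cons, h, h', decide_true, decide_false,
      if_true]
    simp
    omega
  | cons c u ih =>
    simp only [List.cons_append, inversions, ih]
    rw [(List.Perm.append_left u (List.Perm.swap a b v)).countP_eq]
    ring

/-- Tangent-type data satisfying the signed cyclic relation come, up to scaling, from an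
alternating function on lists. -/
lemma exists_alternating {α F : Type*} [DecidableEq α] [Countable α] [Field F] (r : ℕ) {ε : F}
    (hε : ε * ε = 1) (V : Finset α) (T : Finset α → α → F)
    (hne : ∀ Y ⊆ V, Y.card = r → ∀ x ∈ V, x ∉ Y → T Y x ≠ 0)
    (htri : ∀ D ⊆ V, D.card + 1 = r → ∀ x ∈ V, ∀ y ∈ V, ∀ z ∈ V, x ∉ D → y ∉ D → z ∉ D →
        x ≠ y → y ≠ z → z ≠ x →
        T (insert x D) y * T (insert y D) z * T (insert z D) x =
          ε * (T (insert y D) x * T (insert z D) y * T (insert x D) z)) :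
    ∃ f : List α → F, IsAlternating ε f ∧ (∀ l, ¬ l.Nodup → f l = 0) ∧
      (∀ l : List α, l.Nodup → l.toFinset ⊆ V → l.length = r + 1 → f l ≠ 0) ∧
      ∀ l : List α, l.Nodup → l.toFinset ⊆ V → l.length = r →
        ∃ c : F, c ≠ 0 ∧ ∀ x ∈ V, x ∉ l → f (x :: l) = c * T l.toFinset x := by
  obtain ⟨e, he⟩ := exists_injective_nat α
  have hε0 : ε ≠ 0 := fun h => by simp [h] at hε
  set N : Finset α → α → ℕ := fun Y x => (Y.filter fun b => e b < e x).card with hN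
  have hNi : ∀ (D : Finset α) (x y : α), x ∉ D →
      N (insert x D) y = N D y + if e x < e y then 1 else 0 := by
    intro D x y hx
    simp only [hN, Finset.filter_insert]
    split_ifs with h
    · rw [Finset.card_insert_of_notMem (by simp [hx])]
    · rfl
  obtain ⟨c, hc, hcs⟩ := exists_symmetric_scaling r V (fun Y x => ε ^ N Y x * T Y x)
    (fun Y hY hr x hx hxY => mul_ne_zero (pow_ne_zero _ hε0) (hne Y hY hr x hx hxY))
    (fun D hD hr x hx y hy z hz hxD hyD hzD hxy hyz hzx => by
      have h := htri D hD hr x hx y hy z hz hxD hyD hzD hxy hyz hzx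
      have exy : e x ≠ e y := fun h => hxy (he h)
      have eyz : e y ≠ e z := fun h => hyz (he h)
      have ezx : e z ≠ e x := fun h => hzx (he h)
      have hs : ε ^ ((if e x < e y then 1 else 0) + (if e y < e z then 1 else 0) +
          (if e z < e x then 1 else 0)) * ε =
          ε ^ ((if e y < e x then 1 else 0) + (if e z < e y then 1 else 0) +
          (if e x < e z then 1 else 0)) := by
        rcases lt_or_gt_of_ne exy with h1 | h1 <;> rcases lt_or_gt_of_ne eyz with h2 | h2 <;>
        rcases lt_or_gt_of_ne ezx with h3 | h3 <;>
        first
          | omega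
          | (simp only [h1, h2, h3, h1.not_gt, h2.not_gt, h3.not_gt, if_true, if_false]
             linear_combination hε)
          | (simp only [h1, h2, h3, h1.not_gt, h2.not_gt, h3.not_gt, if_true, if_false]
             linear_combination ε * hε)
          | (simp only [h1, h2, h3, h1.not_gt, h2.not_gt, h3.not_gt, if_true, if_false]
             linear_combination)
      simp only [hNi _ _ _ hxD, hNi _ _ _ hyD, hNi _ _ _ hzD, pow_add] at hs ⊢
      linear_combination (ε ^ N D x * ε ^ N D y * ε ^ N D z) *
        ((ε ^ (if e x < e y then 1 else 0) * ε ^ (if e y < e z then 1 else 0) *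
          ε ^ (if e z < e x then 1 else 0)) * h +
          (T (insert y D) x * T (insert z D) y * T (insert x D) z) * hs))
  have hg : ∀ C : Finset α, ∃ b : F, C ⊆ V → C.card = r + 1 → b ≠ 0 ∧
      ∀ x ∈ C, b = c (C.erase x) * (ε ^ N (C.erase x) x * T (C.erase x) x) := by
    intro C
    by_cases hC : C ⊆ V ∧ C.card = r + 1
    · obtain ⟨x, hx⟩ : C.Nonempty := Finset.card_pos.1 (by omega)
      refine ⟨c (C.erase x) * (ε ^ N (C.erase x) x * T (C.erase x) x), fun hCV hCr => ⟨?_, ?_⟩⟩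
      · have h1 := (Finset.erase_subset x C).trans hCV
        have h2 : (C.erase x).card = r := by rw [Finset.card_erase_of_mem hx]; omega
        exact mul_ne_zero (hc _ h1 h2) (mul_ne_zero (pow_ne_zero _ hε0)
          (hne _ h1 h2 x (hCV hx) (Finset.notMem_erase x C)))
      · intro y hy
        rcases eq_or_ne x y with rfl | hxy
        · rfl
        have hyx := Finset.mem_erase.2 ⟨hxy.symm, hy⟩
        have h1 : insert y ((C.erase x).erase y) = C.erase x := Finset.insert_erase hyx
        have h2 : insert x ((C.erase x).erase y) = C.erase y := by
          rw [Finset.erase_right_comm, Finset.insert_erase (Finset.mem_erase.2 ⟨hxy, hx⟩)]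
        have := hcs ((C.erase x).erase y)
          (((Finset.erase_subset _ _).trans (Finset.erase_subset _ _)).trans hCV)
          (by rw [Finset.card_erase_add_one hyx, Finset.card_erase_of_mem hx]; omega)
          x (hCV hx) y (hCV hy) (by simp) (by simp) hxy
        rw [h1, h2] at this
        exact this.symm
    · exact ⟨0, fun h1 h2 => absurd ⟨h1, h2⟩ hC⟩
  choose g hg using hg
  refine ⟨fun l => if l.Nodup then ε ^ inversions e l * g l.toFinset else 0, ?_,
    fun l hl => if_neg hl, ?_, ?_⟩
  · intro u a b v
    have hp : (u ++ a :: b :: v).Perm (u ++ b :: a :: v) :=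
      List.Perm.append_left u (List.Perm.swap b a v)
    simp only [hp.nodup_iff, List.toFinset_eq_of_perm _ _ hp]
    by_cases hn : (u ++ b :: a :: v).Nodup
    · rw [if_pos hn, if_pos hn]
      have hab : a ≠ b := by
        have := (List.nodup_append.1 hn).2.1
        simp only [List.nodup_cons, List.mem_cons, not_or] at this
        exact fun h => this.1.1 h.symm
      rcases lt_or_gt_of_ne (fun h => hab (he h) : e a ≠ e b) with h | h
      · rw [inversions_swap e u a b v h, pow_succ]
        linear_combination -(ε ^ inversions e (u ++ a :: b :: v)) *
          g (u ++ b :: a :: v).toFinset * hε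
      · rw [inversions_swap e u b a v h, pow_succ]
        ring
    · simp [if_neg hn]
  · intro l hl hlV hlr
    simp only [if_pos hl]
    exact mul_ne_zero (pow_ne_zero _ hε0)
      (hg _ hlV (by rw [List.toFinset_card_of_nodup hl, hlr])).1
  · intro l hl hlV hlr
    refine ⟨ε ^ inversions e l * c l.toFinset, mul_ne_zero (pow_ne_zero _ hε0)
      (hc _ hlV (by rw [List.toFinset_card_of_nodup hl, hlr])), fun x hx hxl => ?_⟩
    have hn : (x :: l).Nodup := List.nodup_cons.2 ⟨hxl, hl⟩
    have hxl' : x ∉ l.toFinset := by simpa using hxl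
    have := (hg (insert x l.toFinset) (Finset.insert_subset hx hlV) (by
      rw [Finset.card_insert_of_notMem hxl', List.toFinset_card_of_nodup hl, hlr])).2 x
      (Finset.mem_insert_self _ _)
    rw [Finset.erase_insert hxl'] at this
    simp only [if_pos hn, List.toFinset_cons, this, inversions]
    have hcount : l.countP (fun b => decide (e b < e x)) = N l.toFinset x := by
      simp only [hN]
      rw [List.countP_eq_length_filter, ← List.toFinset_card_of_nodup (hl.filter _),
        List.toFinset_filter]
      simp
    have h2 : ε ^ N l.toFinset x * ε ^ N l.toFinset x = 1 := by rw [← mul_pow, hε, one_pow]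
    rw [hcount, pow_add]
    linear_combination (ε ^ inversions e l * c l.toFinset * T l.toFinset x) * h2

lemma segreP_cons {F : Type} [Field F] [DecidableEq F] {k : ℕ}
    (T : Finset (Fin k → F) → (Fin k → F) → F)
    (D : Finset (Fin k → F)) (a b : Fin k → F) (A B : List (Fin k → F)) :
    segreP T D (a :: A) (b :: B) =
      T (D ∪ B.toFinset) a * (T (D ∪ B.toFinset) b)⁻¹ * segreP T (insert a D) A B := by
  unfold segreP
  rw [List.length_cons, Finset.prod_range_succ', mul_comm]
  congr 1
  · simp
  · refine Finset.prod_congr rfl fun j _ => ?_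
    have : D ∪ ((a :: A).take (j + 1)).toFinset ∪ ((b :: B).drop (j + 1 + 1)).toFinset =
        insert a D ∪ (A.take j).toFinset ∪ (B.drop (j + 1)).toFinset := by
      ext; simp
    rw [this]
    simp

lemma List.Nodup.cons_append_cons_append {α : Type*} {a b : α} {A B D : List α}
    (h : (a :: A ++ b :: B ++ D).Nodup) :
    (A ++ B ++ a :: D).Nodup ∧ (B ++ D).Nodup ∧ a ∉ B ++ D ∧ b ∉ B ++ D := by
  simp only [List.nodup_append, List.nodup_cons, List.mem_append, List.mem_cons,
    List.cons_append] at h ⊢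
  grind

/-- The Segre product telescopes in terms of an alternating function representing the tangent
functions. -/
lemma segreP_eq_div {F : Type} [Field F] [DecidableEq F] {k r : ℕ} {ε : F} (hε : ε * ε = 1)
    (V : Finset (Fin k → F)) (T : Finset (Fin k → F) → (Fin k → F) → F)
    (f : List (Fin k → F) → F) (hf : IsAlternating ε f)
    (hf0 : ∀ l : List (Fin k → F), l.Nodup → l.toFinset ⊆ V → l.length = r + 1 → f l ≠ 0)
    (hfT : ∀ l : List (Fin k → F), l.Nodup → l.toFinset ⊆ V → l.length = r →
        ∃ c : F, c ≠ 0 ∧ ∀ x ∈ V, x ∉ l → f (x :: l) = c * T l.toFinset x)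
    (A : List (Fin k → F)) :
    ∀ B D, (A ++ B ++ D).Nodup → (A ++ B ++ D).toFinset ⊆ V → A.length = B.length →
      A.length + D.length = r + 1 → segreP T D.toFinset A B = f (A ++ D) / f (B ++ D) := by
  induction A with
  | nil =>
    intro B D hn hV hl hr
    obtain rfl : B = [] := List.length_eq_zero_iff.1 (by simpa using hl.symm)
    have := hf0 D (by simpa using hn) (by simpa using hV) (by simpa using hr)
    simp [segreP, this]
  | cons a A ih =>
    intro B D hn hV hl hr
    cases B with
    | nil => simp at hl
    | cons b B =>
      have hε0 : ε ≠ 0 := fun h => by simp [h] at hε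
      simp only [List.length_cons, Nat.add_right_cancel_iff] at hl hr
      obtain ⟨hn', hBD, haBD, hbBD⟩ := hn.cons_append_cons_append
      rw [segreP_cons]
      have hVm : ∀ x, x = a ∨ x = b ∨ x ∈ A ∨ x ∈ B ∨ x ∈ D → x ∈ V := fun x hx =>
        hV (by simpa [or_assoc] using hx)
      have h1 := ih B (a :: D) hn'
        (fun x hx => hVm x (by simp at hx; tauto)) hl (by simp; omega)
      rw [List.toFinset_cons] at h1
      obtain ⟨c, hc, hcT⟩ := hfT (B ++ D) hBD (fun x hx => hVm x (by simp at hx; tauto))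
        (by simp; omega)
      have ha := hcT a (hVm a (by simp)) haBD
      have hb := hcT b (hVm b (by simp)) hbBD
      have na : f (a :: (B ++ D)) ≠ 0 := hf0 _ (List.nodup_cons.2 ⟨haBD, hBD⟩)
        (fun x hx => hVm x (by simp at hx; tauto)) (by simp; omega)
      have nb : f (b :: (B ++ D)) ≠ 0 := hf0 _ (List.nodup_cons.2 ⟨hbBD, hBD⟩)
        (fun x hx => hVm x (by simp at hx; tauto)) (by simp; omega)
      have m1 := hf.move a A D []
      have m2 := hf.move a B D []
      simp only [List.nil_append, List.cons_append] at m1 m2 ⊢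
      rw [List.toFinset_append, Finset.union_comm] at ha hb
      rw [h1, m1, hb]
      rw [ha] at m2
      rw [ha] at na
      rw [hb] at nb
      have nT := right_ne_zero_of_mul nb
      have nTa := right_ne_zero_of_mul na
      have nB : f (B ++ a :: D) ≠ 0 := fun h => na (by rw [m2, h, mul_zero])
      rw [hl]
      field_simp
      linear_combination f (A ++ a :: D) * m2

lemma detCols_eq_detRowAlternating {F : Type} [CommRing F] {k : ℕ} (L : List (Fin k → F)) :
    detCols L = Matrix.detRowAlternating fun j : Fin k => L.getD (j : ℕ) 0 := by
  rw [detCols, ← Matrix.det_transpose]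
  rfl

/-- The determinant as a linear form in its first column. -/
lemma exists_linear_detCols_cons {F : Type} [CommRing F] {k : ℕ} (hk : 0 < k)
    (l : List (Fin k → F)) :
    ∃ φ : (Fin k → F) →ₗ[F] F, ∀ z, φ z = detCols (z :: l) := by
  refine ⟨Matrix.detRowAlternating.toMultilinearMap.toLinearMap
    (fun j : Fin k => ((0 : Fin k → F) :: l).getD (j : ℕ) 0) ⟨0, hk⟩, fun z => ?_⟩
  rw [detCols_eq_detRowAlternating]
  change Matrix.detRowAlternating (Function.update _ _ _) = _
  congr 1
  ext ⟨j, hj⟩ i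
  cases j with
  | zero => simp [Function.update]
  | succ j => simp [Function.update]

lemma detCols_swap {F : Type} [CommRing F] {k : ℕ} (u : List (Fin k → F)) (a b : Fin k → F)
    (v : List (Fin k → F)) (h : u.length + 1 < k) :
    detCols (u ++ a :: b :: v) = -detCols (u ++ b :: a :: v) := by
  rw [detCols_eq_detRowAlternating, detCols_eq_detRowAlternating]
  have hne : (⟨u.length, by omega⟩ : Fin k) ≠ ⟨u.length + 1, h⟩ := by simp
  rw [← AlternatingMap.map_swap _ _ hne]
  congr 1
  funext j
  simp only [Function.comp, Equiv.swap_apply_def]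
  split_ifs with h1 h2
  · subst h1; simp [List.getD_eq_getElem?_getD]
  · subst h2; simp [List.getD_eq_getElem?_getD]
  · have h1' : (j : ℕ) ≠ u.length := fun h => h1 (Fin.ext h)
    have h2' : (j : ℕ) ≠ u.length + 1 := fun h => h2 (Fin.ext h)
    rcases lt_or_ge (j : ℕ) u.length with h3 | h3
    · simp [List.getD_eq_getElem?_getD, List.getElem?_append_left h3]
    · obtain ⟨i, hi⟩ : ∃ i, (j : ℕ) = u.length + (i + 2) := ⟨j - u.length - 2, by omega⟩
      simp [List.getD_eq_getElem?_getD, hi, List.getElem?_append_right]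

lemma detCols_of_not_nodup {F : Type} [CommRing F] {k : ℕ} {l : List (Fin k → F)}
    (hl : l.length = k) (h : ¬ l.Nodup) : detCols l = 0 := by
  rw [detCols_eq_detRowAlternating]
  refine AlternatingMap.map_eq_zero_of_not_injective _ _ fun hi => h ?_
  rw [List.nodup_iff_injective_get]
  intro a b hab
  have := @hi ⟨a, by omega⟩ ⟨b, by omega⟩ (by
    simpa [List.getD_eq_getElem?_getD] using hab)
  exact Fin.ext (by simpa using this)

lemma detCols_ne_zero {F : Type} [Field F] [DecidableEq F] {k : ℕ} {l : List (Fin k → F)}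
    (hl : l.length = k) (h : l.Nodup)
    (hli : LinearIndependent F fun v : {x // x ∈ l.toFinset} => (v : Fin k → F)) :
    detCols l ≠ 0 := by
  rw [detCols, ← Matrix.det_transpose]
  rw [← isUnit_iff_ne_zero, ← Matrix.isUnit_iff_isUnit_det,
    ← Matrix.linearIndependent_rows_iff_isUnit]
  have := hli.comp (fun j : Fin k => ⟨l.get (j.cast hl.symm), by simp⟩) (by
    intro a b hab
    have := List.nodup_iff_injective_get.1 h (Subtype.ext_iff.1 hab)
    simpa [Fin.ext_iff] using this)
  convert this using 1
  funext j i
  have hj : (j : ℕ) < l.length := by omega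
  simp [List.getD_eq_getElem?_getD, hj]

/-- Lagrange interpolation for products of linear forms. -/
lemma sum_prod_mul_prod_inv_eq_zero {V ι F : Type*} [DecidableEq V] [Field F]
    (w : V → V → F) (hw : ∀ a b, w a b = -w b a) (hw0 : ∀ a, w a a = 0)
    (α : ι → V → F) (Φ : Finset ι) :
    ∀ E : Finset V, E.card = Φ.card + 2 → (∀ a ∈ E, ∀ b ∈ E, a ≠ b → w a b ≠ 0) →
      (∀ i ∈ Φ, ∀ b ∈ E, ∀ c ∈ E, b ≠ c → ∃ r s : F, ∀ a ∈ E, α i a = r * w a b + s * w a c) →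
      ∑ a ∈ E, (∏ i ∈ Φ, α i a) * ∏ z ∈ E.erase a, (w a z)⁻¹ = 0 := by
  classical
  induction Φ using Finset.induction_on with
  | empty =>
    intro E hE _ _
    obtain ⟨a, b, hab, rfl⟩ := Finset.card_eq_two.1 hE
    have h1 : ({a, b} : Finset V).erase a = {b} := by ext; simp; grind
    have h2 : ({a, b} : Finset V).erase b = {a} := by ext; simp; grind
    rw [Finset.sum_pair hab, h1, h2, Finset.prod_singleton, Finset.prod_singleton, hw a b]
    simp [inv_neg]
  | insert i Φ hi ih =>
    intro E hE hne hα
    rw [Finset.card_insert_of_notMem hi] at hE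
    have key : ∀ b ∈ E, ∑ a ∈ E, w a b * ((∏ i ∈ Φ, α i a) * ∏ z ∈ E.erase a, (w a z)⁻¹) = 0 := by
      intro b hb
      rw [← Finset.sum_erase E (a := b) (by rw [hw0, zero_mul])]
      rw [← ih (E.erase b) (by rw [Finset.card_erase_of_mem hb]; omega)
        (fun a ha c hc => hne a (Finset.mem_of_mem_erase ha) c (Finset.mem_of_mem_erase hc))
        (fun j hj c hc d hd hcd => by
          obtain ⟨r, s, h⟩ := hα j (Finset.mem_insert_of_mem hj) c (Finset.mem_of_mem_erase hc) d
            (Finset.mem_of_mem_erase hd) hcd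
          exact ⟨r, s, fun a ha => h a (Finset.mem_of_mem_erase ha)⟩)]
      refine Finset.sum_congr rfl fun a ha => ?_
      obtain ⟨hab, haE⟩ := Finset.mem_erase.1 ha
      rw [← Finset.mul_prod_erase (E.erase a) _ (Finset.mem_erase.2 ⟨hab.symm, hb⟩),
        Finset.erase_right_comm]
      have := hne a haE b hb hab
      field_simp
    obtain ⟨b, hb, c, hc, hbc⟩ := Finset.one_lt_card.1 (show 1 < E.card by omega)
    obtain ⟨r, s, h⟩ := hα i (Finset.mem_insert_self _ _) b hb c hc hbc
    have : ∀ a ∈ E, (∏ i ∈ insert i Φ, α i a) * ∏ z ∈ E.erase a, (w a z)⁻¹ =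
        r * (w a b * ((∏ i ∈ Φ, α i a) * ∏ z ∈ E.erase a, (w a z)⁻¹)) +
        s * (w a c * ((∏ i ∈ Φ, α i a) * ∏ z ∈ E.erase a, (w a z)⁻¹)) := by
      intro a ha
      rw [Finset.prod_insert hi, h a ha]
      ring
    rw [Finset.sum_congr rfl this, Finset.sum_add_distrib, ← Finset.mul_sum, ← Finset.mul_sum,
      key b hb, key c hc]
    ring

lemma prod_erase_zero_eq_neg_one (F : Type*) [Field F] [Fintype F] [DecidableEq F] :
    ∏ x ∈ (Finset.univ : Finset F).erase 0, x = -1 := by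
  have h := congrArg Units.val (FiniteField.prod_univ_units_id_eq_neg_one (K := F))
  rw [Units.coe_prod] at h
  rw [Units.val_neg, Units.val_one] at h
  rw [← h]
  symm
  refine Finset.prod_bij (fun u _ => (u : F)) (by simp) (fun a _ b _ h => Units.ext h) ?_ (by simp)
  intro b hb
  exact ⟨Units.mk0 b (Finset.ne_of_mem_erase hb), by simp, rfl⟩

/-- The tangent forms at `Y` together with the forms spanned by the points off `Y ∪ {y, z}`
exhaust the nonzero elements of the field. -/
lemma prod_div_mul_prod_neg_div {F : Type} [Field F] [Fintype F] [DecidableEq F] {k t : ℕ}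
    (S Y : Finset (Fin k → F)) (hY : Y ⊆ S) (hYc : Y.card + 2 = k)
    (hspan : ∀ A ⊆ S, A.card = k → Submodule.span F (A : Set (Fin k → F)) = ⊤)
    (ht : S.card + t + 1 = Fintype.card F + k)
    (Φ : Finset ((Fin k → F) →ₗ[F] F)) (hΦ : Φ.card = t)
    (hind : ∀ α ∈ Φ, ∀ β ∈ Φ, α ≠ β → ∀ c : F, α ≠ c • β)
    (hvan : ∀ α ∈ Φ, ∀ v ∈ Y, α v = 0) (hne : ∀ α ∈ Φ, ∀ s ∈ S, s ∉ Y → α s ≠ 0)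
    (y z : Fin k → F) (hy : y ∈ S) (hz : z ∈ S) (hyY : y ∉ Y) (hzY : z ∉ Y) (hyz : y ≠ z)
    (φ ψ : (Fin k → F) →ₗ[F] F) (δ : F) (hδ : δ ≠ 0)
    (hφ : ∀ v ∈ Y, φ v = 0) (hψ : ∀ v ∈ Y, ψ v = 0) (hφz : φ z = 0) (hψy : ψ y = 0)
    (hφy : φ y = δ) (hψz : ψ z = δ)
    (hφne : ∀ s ∈ S \ insert y (insert z Y), φ s ≠ 0)
    (hψne : ∀ s ∈ S \ insert y (insert z Y), ψ s ≠ 0) :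
    (∏ α ∈ Φ, α y / α z) * ∏ s ∈ S \ insert y (insert z Y), (-ψ s / φ s) = -1 := by
  have hsub : ∀ s ∈ S, ∀ s' ∈ S, insert s (insert s' Y) ⊆ S := fun s hs s' hs' =>
    Finset.insert_subset hs (Finset.insert_subset hs' hY)
  have hcard : ∀ s s', s ∉ Y → s' ∉ Y → s ≠ s' → (insert s (insert s' Y)).card = k :=
    fun s s' h h' hss => by
      rw [Finset.card_insert_of_notMem (by simp [h, hss]), Finset.card_insert_of_notMem h', hYc]
  have hext : ∀ (f g : (Fin k → F) →ₗ[F] F), (∀ v ∈ Y, f v = 0) → (∀ v ∈ Y, g v = 0) →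
      ∀ s ∈ S, ∀ s' ∈ S, s ∉ Y → s' ∉ Y → s ≠ s' → f s = g s → f s' = g s' → f = g := by
    intro f g hf hg s hs s' hs' hsY hsY' hss h h'
    refine LinearMap.ext_on
      (hspan _ (hsub s hs s' hs') (hcard s s' hsY hsY' hss)) fun v hv => ?_
    simp only [Finset.coe_insert, Set.mem_insert_iff, Finset.mem_coe] at hv
    rcases hv with rfl | rfl | hv
    · exact h
    · exact h'
    · rw [hf v hv, hg v hv]
  set R := S \ insert y (insert z Y) with hR
  have hRS : ∀ s ∈ R, s ∈ S ∧ s ∉ Y := by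
    intro s hs
    simp only [hR, Finset.mem_sdiff, Finset.mem_insert, not_or] at hs
    exact ⟨hs.1, hs.2.2.2⟩
  have hinj1 : Set.InjOn (fun α : (Fin k → F) →ₗ[F] F => α y / α z) Φ := by
    intro α hα β hβ h
    by_contra hab
    have n1 := hne α hα z hz hzY
    have n2 := hne β hβ z hz hzY
    refine hind α hα β hβ hab (α z / β z) (hext _ _ (hvan α hα) (fun v hv => by
      simp [hvan β hβ v hv]) y hy z hz hyY hzY hyz ?_ ?_)
    · simp only at h
      simp only [LinearMap.smul_apply, smul_eq_mul]
      field_simp at h ⊢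
      linear_combination h
    · simp only [LinearMap.smul_apply, smul_eq_mul]
      field_simp
  have hinj2 : Set.InjOn (fun s => -ψ s / φ s) R := by
    intro s hs s' hs' h
    by_contra hss
    have n1 := hφne s hs
    have n2 := hφne s' hs'
    have := hext ψ ((ψ s / φ s) • φ) hψ (fun v hv => by simp [hφ v hv]) s (hRS s hs).1 s'
      (hRS s' hs').1 (hRS s hs).2 (hRS s' hs').2 hss (by simp; field_simp) (by
        simp only at h
        simp only [LinearMap.smul_apply, smul_eq_mul]
        field_simp at h ⊢
        linear_combination h)
    have h2 := congrArg (fun f : (Fin k → F) →ₗ[F] F => f z) this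
    simp [hψz, hφz, hδ] at h2
  have hdisj : Disjoint (Φ.image fun α : (Fin k → F) →ₗ[F] F => α y / α z)
      (R.image fun s => -ψ s / φ s) := by
    rw [Finset.disjoint_left]
    intro c h1 h2
    obtain ⟨α, hα, rfl⟩ := Finset.mem_image.1 h1
    obtain ⟨s, hs, h⟩ := Finset.mem_image.1 h2
    have hα' : δ • α = α y • φ + α z • ψ :=
      hext _ _ (fun v hv => by simp [hvan α hα v hv])
        (fun v hv => by simp [hφ v hv, hψ v hv]) y hy z hz hyY hzY hyz
        (by simp [hφy, hψy, mul_comm]) (by simp [hφz, hψz, mul_comm])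
    have h2 := congrArg (fun f : (Fin k → F) →ₗ[F] F => f s) hα'
    simp only [LinearMap.smul_apply, LinearMap.add_apply, smul_eq_mul] at h2
    have n1 := hφne s hs
    have n2 := hne α hα z hz hzY
    have n3 := hne α hα s (hRS s hs).1 (hRS s hs).2
    field_simp at h
    exact mul_ne_zero hδ n3 (by rw [h2]; linear_combination -h)
  have huniv : (Φ.image fun α : (Fin k → F) →ₗ[F] F => α y / α z) ∪
      (R.image fun s => -ψ s / φ s) = Finset.univ.erase 0 := by
    refine Finset.eq_of_subset_of_card_le ?_ ?_
    · intro c hc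
      refine Finset.mem_erase.2 ⟨?_, Finset.mem_univ _⟩
      rcases Finset.mem_union.1 hc with hc | hc
      · obtain ⟨α, hα, rfl⟩ := Finset.mem_image.1 hc
        exact div_ne_zero (hne α hα y hy hyY) (hne α hα z hz hzY)
      · obtain ⟨s, hs, rfl⟩ := Finset.mem_image.1 hc
        exact div_ne_zero (neg_ne_zero.2 (hψne s hs)) (hφne s hs)
    · rw [Finset.card_union_of_disjoint hdisj, Finset.card_image_of_injOn hinj1,
        Finset.card_image_of_injOn hinj2, Finset.card_erase_of_mem (Finset.mem_univ _),
        Finset.card_univ, hR, Finset.card_sdiff_of_subset (hsub y hy z hz), hcard y z hyY hzY hyz]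
      omega
  rw [← prod_erase_zero_eq_neg_one F, ← huniv, Finset.prod_union hdisj,
    Finset.prod_image hinj1, Finset.prod_image hinj2]

section Arc

variable {F : Type} [Field F] [DecidableEq F] {k t : ℕ} {S : Finset (Fin k → F)}
  {T : Finset (Fin k → F) → (Fin k → F) → F}

lemma detCols_ne_zero_of_arc
    (harc : ∀ A ⊆ S, A.card = k →
      LinearIndependent F (fun v : {x // x ∈ A} => (v : Fin k → F)) ∧
      Submodule.span F (A : Set (Fin k → F)) = ⊤)
    {l : List (Fin k → F)} (hl : l.length = k) (hn : l.Nodup) (hS : ∀ v ∈ l, v ∈ S) :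
    detCols l ≠ 0 :=
  detCols_ne_zero hl hn (harc l.toFinset (fun v hv => hS v (List.mem_toFinset.1 hv))
    (by rw [List.toFinset_card_of_nodup hn, hl])).1

lemma tangent_mul_prod_eq_neg [Fintype F]
    (harc : ∀ A ⊆ S, A.card = k →
      LinearIndependent F (fun v : {x // x ∈ A} => (v : Fin k → F)) ∧
      Submodule.span F (A : Set (Fin k → F)) = ⊤)
    (ht : S.card + t + 1 = Fintype.card F + k) (hT : IsTangentFamily t S T)
    (D : Finset (Fin k → F)) (hD : D ⊆ S) (hDc : D.card + 3 = k) (x y z : Fin k → F)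
    (hx : x ∈ S) (hy : y ∈ S) (hz : z ∈ S) (hxD : x ∉ D) (hyD : y ∉ D) (hzD : z ∉ D)
    (hxy : x ≠ y) (hyz : y ≠ z) (hzx : z ≠ x) :
    T (insert x D) y * ∏ s ∈ S \ ({x, y, z} ∪ D),
      (-detCols (s :: x :: y :: D.toList) / detCols (s :: z :: x :: D.toList)) =
      -T (insert x D) z := by
  have hDl : D.toList.length + 3 = k := by rw [Finset.length_toList, hDc]
  have hk : 0 < k := by omega
  obtain ⟨Φ, hΦ, hind, hvan, hne, hTp⟩ := hT (insert x D) (Finset.insert_subset hx hD)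
    (by rw [Finset.card_insert_of_notMem hxD]; omega)
  obtain ⟨φ, hφ⟩ := exists_linear_detCols_cons hk (z :: x :: D.toList)
  obtain ⟨ψ, hψ⟩ := exists_linear_detCols_cons hk (x :: y :: D.toList)
  have hrep : ∀ a b c : Fin k → F, ¬ (a :: b :: c :: D.toList).Nodup →
      detCols (a :: b :: c :: D.toList) = 0 := fun a b c h =>
    detCols_of_not_nodup (by simpa using hDl) h
  have hnz : ∀ a b c : Fin k → F, a ∈ S → b ∈ S → c ∈ S → a ∉ D → b ∉ D → c ∉ D → a ≠ b →
      b ≠ c → a ≠ c → detCols (a :: b :: c :: D.toList) ≠ 0 := by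
    intro a b c ha hb hc ha' hb' hc' hab hbc hac
    refine detCols_ne_zero_of_arc harc (by simpa using hDl) ?_ ?_
    · simp [ha', hb', hc', hab, hbc, hac, Finset.nodup_toList]
    · intro v hv
      simp only [List.mem_cons, Finset.mem_toList] at hv
      rcases hv with rfl | rfl | rfl | hv
      exacts [ha, hb, hc, hD hv]
  have hyY : y ∉ insert x D := by simp [hyD, hxy.symm]
  have hzY : z ∉ insert x D := by simp [hzD, hzx]
  have hR : S \ insert y (insert z (insert x D)) = S \ ({x, y, z} ∪ D) := by
    congr 1
    ext v
    simp only [Finset.mem_insert, Finset.mem_union, Finset.mem_singleton]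
    tauto
  have hRm : ∀ s ∈ S \ insert y (insert z (insert x D)),
      s ∈ S ∧ s ≠ y ∧ s ≠ z ∧ s ≠ x ∧ s ∉ D := by
    intro s hs
    simpa only [Finset.mem_sdiff, Finset.mem_insert, not_or] using hs
  have hyzx : φ y = ψ z := by
    rw [hφ, hψ]
    have h1 := detCols_swap [] y z (x :: D.toList) (by simp; omega)
    have h2 := detCols_swap [z] y x D.toList (by simp; omega)
    simp only [List.nil_append, List.cons_append] at h1 h2
    rw [h1, h2, neg_neg]
  have key := prod_div_mul_prod_neg_div S (insert x D) (Finset.insert_subset hx hD)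
    (by rw [Finset.card_insert_of_notMem hxD]; omega) (fun A hA hAc => (harc A hA hAc).2) ht Φ hΦ
    hind hvan hne y z hy hz hyY hzY hyz φ ψ (φ y)
    (by rw [hφ]; exact hnz _ _ _ hy hz hx hyD hzD hxD hyz hzx hxy.symm)
    (fun v hv => by
      rw [hφ]
      refine hrep _ _ _ fun h => ?_
      simp only [Finset.mem_insert] at hv
      rcases hv with rfl | hv
      · simp at h
      · simp [hv] at h)
    (fun v hv => by
      rw [hψ]
      refine hrep _ _ _ fun h => ?_
      simp only [Finset.mem_insert] at hv
      rcases hv with rfl | hv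
      · simp at h
      · simp [hv] at h)
    (by rw [hφ]; exact hrep _ _ _ (by simp))
    (by rw [hψ]; exact hrep _ _ _ (by simp)) rfl hyzx.symm
    (fun s hs => by
      obtain ⟨h0, h1, h2, h3, h4⟩ := hRm s hs
      rw [hφ]
      exact hnz _ _ _ h0 hz hx h4 hzD hxD h2 hzx h3)
    (fun s hs => by
      obtain ⟨h0, h1, h2, h3, h4⟩ := hRm s hs
      rw [hψ]
      exact hnz _ _ _ h0 hx hy h4 hxD hyD h3 hxy h1)
  rw [hR, Finset.prod_div_distrib, ← hTp, ← hTp] at key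
  simp only [hφ, hψ] at key
  have hTz : T (insert x D) z ≠ 0 := by
    rw [hTp]
    exact Finset.prod_ne_zero_iff.2 fun α hα => hne α hα z hz hzY
  field_simp at key
  simpa only [neg_div] using key

/-- The lemma of tangents. -/
lemma tangent_cyclic [Fintype F]
    (harc : ∀ A ⊆ S, A.card = k →
      LinearIndependent F (fun v : {x // x ∈ A} => (v : Fin k → F)) ∧
      Submodule.span F (A : Set (Fin k → F)) = ⊤)
    (ht : S.card + t + 1 = Fintype.card F + k) (hT : IsTangentFamily t S T)
    (D : Finset (Fin k → F)) (hD : D ⊆ S) (hDc : D.card + 3 = k) (x y z : Fin k → F)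
    (hx : x ∈ S) (hy : y ∈ S) (hz : z ∈ S) (hxD : x ∉ D) (hyD : y ∉ D) (hzD : z ∉ D)
    (hxy : x ≠ y) (hyz : y ≠ z) (hzx : z ≠ x) :
    T (insert x D) y * T (insert y D) z * T (insert z D) x =
      (-1) ^ (t + 1) * (T (insert y D) x * T (insert z D) y * T (insert x D) z) := by
  have hset : ∀ a b c : Fin k → F, S \ ({a, b, c} ∪ D) = S \ ({b, c, a} ∪ D) := by
    intro a b c
    congr 2
    ext v
    simp only [Finset.mem_insert, Finset.mem_singleton]
    tauto
  have h1 := tangent_mul_prod_eq_neg harc ht hT D hD hDc x y z hx hy hz hxD hyD hzD hxy hyz hzx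
  have h2 := tangent_mul_prod_eq_neg harc ht hT D hD hDc y z x hy hz hx hyD hzD hxD hyz hzx hxy
  have h3 := tangent_mul_prod_eq_neg harc ht hT D hD hDc z x y hz hx hy hzD hxD hyD hzx hxy hyz
  rw [← hset x y z] at h2
  rw [← hset y z x, ← hset x y z] at h3
  set R := S \ ({x, y, z} ∪ D) with hR
  have hDl : D.toList.length + 3 = k := by rw [Finset.length_toList, hDc]
  have hnz : ∀ a b c : Fin k → F, a ∈ R → b ∈ S → c ∈ S → b ∈ ({x, y, z} : Finset (Fin k → F)) →
      c ∈ ({x, y, z} : Finset (Fin k → F)) → b ∉ D → c ∉ D → b ≠ c →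
      detCols (a :: b :: c :: D.toList) ≠ 0 := by
    intro a b c ha hb hc hb1 hc1 hb' hc' hbc
    simp only [hR, Finset.mem_sdiff, Finset.mem_union, not_or] at ha
    refine detCols_ne_zero_of_arc harc (by simpa using hDl) ?_ ?_
    · have hab : a ≠ b := fun h => ha.2.1 (h ▸ hb1)
      have hac : a ≠ c := fun h => ha.2.1 (h ▸ hc1)
      simp [ha.2.2, hb', hc', hab, hbc, hac, Finset.nodup_toList]
    · intro v hv
      simp only [List.mem_cons, Finset.mem_toList] at hv
      rcases hv with rfl | rfl | rfl | hv
      exacts [ha.1, hb, hc, hD hv]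
  have hprod : (∏ s ∈ R, (-detCols (s :: x :: y :: D.toList) / detCols (s :: z :: x :: D.toList))) *
      (∏ s ∈ R, (-detCols (s :: y :: z :: D.toList) / detCols (s :: x :: y :: D.toList))) *
      (∏ s ∈ R, (-detCols (s :: z :: x :: D.toList) / detCols (s :: y :: z :: D.toList))) =
      (-1) ^ R.card := by
    rw [← Finset.prod_mul_distrib, ← Finset.prod_mul_distrib, ← Finset.prod_const]
    refine Finset.prod_congr rfl fun s hs => ?_
    have n1 := hnz s x y hs hx hy (by simp) (by simp) hxD hyD hxy
    have n2 := hnz s y z hs hy hz (by simp) (by simp) hyD hzD hyz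
    have n3 := hnz s z x hs hz hx (by simp) (by simp) hzD hxD hzx
    field_simp
  have hRc : R.card + k = S.card := by
    have h3 : ({x, y, z} : Finset (Fin k → F)).card = 3 := by
      rw [Finset.card_eq_three]
      exact ⟨x, y, z, hxy, hzx.symm, hyz, rfl⟩
    have hd : Disjoint ({x, y, z} : Finset (Fin k → F)) D := by simp [hxD, hyD, hzD]
    have hsub : {x, y, z} ∪ D ⊆ S := by
      refine Finset.union_subset ?_ hD
      simp [Finset.insert_subset_iff, hx, hy, hz]
    have h4 := Finset.card_sdiff_add_card_eq_card hsub
    rw [← hR, Finset.card_union_of_disjoint hd, h3] at h4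
    omega
  have hsign : (-1 : F) ^ R.card * (-1) ^ t = 1 := by
    rw [← pow_add, show R.card + t = Fintype.card F - 1 by omega]
    exact FiniteField.pow_card_sub_one_eq_one _ (by simp)
  have hmul := congrArg₂ (· * ·) (congrArg₂ (· * ·) h1 h2) h3
  have ht2 : (-1 : F) ^ t * (-1) ^ t = 1 := by rw [← mul_pow]; simp
  have hmul2 : T (insert x D) y * T (insert y D) z * T (insert z D) x * (-1) ^ R.card =
      -(T (insert y D) x * T (insert z D) y * T (insert x D) z) := by
    rw [← hprod]
    linear_combination hmul
  rw [pow_succ]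
  linear_combination (-1 : F) ^ t * hmul2 -
    (T (insert x D) y * T (insert y D) z * T (insert z D) x) * hsign

end Arc

/-- The weight of a list `l` inside `U` attached to a function `f` on lists. -/
def listWeight {F : Type} [Field F] [DecidableEq F] {k : ℕ} (f : List (Fin k → F) → F)
    (U : Finset (Fin k → F)) (l : List (Fin k → F)) : F :=
  f l * ∏ z ∈ U \ l.toFinset, (detCols (z :: l))⁻¹

lemma listWeight_perm {F : Type} [Field F] [DecidableEq F] {k r : ℕ}
    {f : List (Fin k → F) → F} (hf : IsAlternating ((-1) ^ r) f) {U : Finset (Fin k → F)}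
    {l₁ l₂ : List (Fin k → F)} (h : l₁.Perm l₂) :
    ∀ u, (u ++ l₁).length + 1 = k → (u ++ l₁).Nodup → (u ++ l₁).toFinset ⊆ U →
      U.card + 1 = r + k → listWeight f U (u ++ l₁) = listWeight f U (u ++ l₂) := by
  induction h with
  | nil => exact fun _ _ _ _ _ => rfl
  | cons x _ ih =>
    intro u h1 h2 h3 h4
    simpa using ih (u ++ [x]) (by simpa using h1) (by simpa using h2) (by simpa using h3) h4
  | swap x y l =>
    intro u h1 h2 h3 h4
    have hp : (u ++ x :: y :: l).Perm (u ++ y :: x :: l) :=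
      List.Perm.append_left u (List.Perm.swap y x l)
    unfold listWeight
    rw [List.toFinset_eq_of_perm _ _ hp, hf u y x l]
    have hd : ∀ z, (detCols (z :: (u ++ y :: x :: l)))⁻¹ =
        (-1) * (detCols (z :: (u ++ x :: y :: l)))⁻¹ := by
      intro z
      have := detCols_swap (z :: u) y x l (by simp at h1 ⊢; omega)
      simp only [List.cons_append] at this
      rw [this, inv_neg, neg_one_mul]
    have hc : (U \ (u ++ y :: x :: l).toFinset).card = r := by
      have := Finset.card_sdiff_add_card_eq_card h3
      rw [List.toFinset_card_of_nodup h2] at this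
      omega
    simp only [hd]
    rw [Finset.prod_mul_distrib, Finset.prod_const, hc]
    have : (-1 : F) ^ r * (-1) ^ r = 1 := by rw [← mul_pow]; simp
    linear_combination (f (u ++ x :: y :: l) *
      ∏ z ∈ U \ (u ++ y :: x :: l).toFinset, (detCols (z :: (u ++ x :: y :: l)))⁻¹) * this
  | trans p1 _ ih1 ih2 =>
    intro u h1 h2 h3 h4
    have hp := List.Perm.append_left u p1
    rw [ih1 u h1 h2 h3 h4]
    exact ih2 u (by rw [← hp.length_eq]; exact h1) (hp.nodup_iff.1 h2)
      (by rw [← List.toFinset_eq_of_perm _ _ hp]; exact h3) h4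

lemma sum_listWeight_insert_eq_zero {F : Type} [Field F] [DecidableEq F] {k t : ℕ}
    {S : Finset (Fin k → F)} {T : Finset (Fin k → F) → (Fin k → F) → F}
    (harc : ∀ A ⊆ S, A.card = k →
      LinearIndependent F (fun v : {x // x ∈ A} => (v : Fin k → F)) ∧
      Submodule.span F (A : Set (Fin k → F)) = ⊤)
    (hT : IsTangentFamily t S T) (htk : t + 3 = k)
    {f : List (Fin k → F) → F} (hf : IsAlternating ((-1) ^ (t + 1)) f)
    (hfT : ∀ l : List (Fin k → F), l.Nodup → l.toFinset ⊆ S → l.length = t + 1 →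
        ∃ c : F, c ≠ 0 ∧ ∀ x ∈ S, x ∉ l → f (x :: l) = c * T l.toFinset x)
    {U : Finset (Fin k → F)} (hU : U ⊆ S) (hUc : U.card + 3 = 2 * k)
    (Y : Finset (Fin k → F)) (hY : Y ⊆ U) (hYc : Y.card + 2 = k) :
    ∑ a ∈ U \ Y, listWeight f U (insert a Y).toList = 0 := by
  have hYl : Y.toList.length + 2 = k := by rw [Finset.length_toList, hYc]
  obtain ⟨Φ, hΦ, -, hvan, -, hTp⟩ := hT Y (hY.trans hU) (by omega)
  obtain ⟨c, -, hc⟩ := hfT Y.toList (Finset.nodup_toList _)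
    (by rw [Finset.toList_toFinset]; exact hY.trans hU) (by omega)
  rw [Finset.toList_toFinset] at hc
  set w : (Fin k → F) → (Fin k → F) → F := fun a z => detCols (z :: a :: Y.toList) with hw
  have hanti : ∀ a b, w a b = -w b a := fun a b =>
    detCols_swap [] b a Y.toList (by simp; omega)
  have hne : ∀ a ∈ U \ Y, ∀ b ∈ U \ Y, a ≠ b → w a b ≠ 0 := by
    intro a ha b hb hab
    rw [Finset.mem_sdiff] at ha hb
    refine detCols_ne_zero_of_arc harc (by simpa using hYl) ?_ ?_
    · simp [ha.2, hb.2, hab.symm, Finset.nodup_toList]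
    · intro v hv
      simp only [List.mem_cons, Finset.mem_toList] at hv
      rcases hv with rfl | rfl | hv
      exacts [hU hb.1, hU ha.1, hU (hY hv)]
  have key := sum_prod_mul_prod_inv_eq_zero w hanti
    (fun a => detCols_of_not_nodup (by simpa using hYl) (by simp))
    (fun (α : (Fin k → F) →ₗ[F] F) a => α a) Φ (U \ Y)
    (by rw [Finset.card_sdiff_of_subset hY]; omega) hne (by
      intro α hα b hb d hd hbd
      obtain ⟨φ, hφ⟩ := exists_linear_detCols_cons (F := F) (by omega) (b :: Y.toList)
      obtain ⟨ψ, hψ⟩ := exists_linear_detCols_cons (F := F) (by omega) (d :: Y.toList)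
      have nbd := hne b hb d hd hbd
      have ndb := hne d hd b hb hbd.symm
      have h0 : ∀ v e : Fin k → F, ¬ (v :: e :: Y.toList).Nodup →
          detCols (v :: e :: Y.toList) = 0 := fun v e h =>
        detCols_of_not_nodup (by simpa using hYl) h
      rw [Finset.mem_sdiff] at hb hd
      have heq : α = (α d / w b d) • φ + (α b / w d b) • ψ := by
        refine LinearMap.ext_on (harc (insert b (insert d Y))
          (Finset.insert_subset (hU hb.1) (Finset.insert_subset (hU hd.1) (hY.trans hU))) (by
          rw [Finset.card_insert_of_notMem (by simp [hb.2, hbd]),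
            Finset.card_insert_of_notMem hd.2, hYc])).2 fun v hv => ?_
        simp only [Finset.coe_insert, Set.mem_insert_iff, Finset.mem_coe] at hv
        simp only [LinearMap.add_apply, LinearMap.smul_apply, smul_eq_mul, hφ, hψ]
        rcases hv with rfl | rfl | hv
        · rw [h0 v v (by simp)]
          simp only [hw] at ndb ⊢
          field_simp
          ring
        · rw [h0 v v (by simp)]
          simp only [hw] at nbd ⊢
          field_simp
          ring
        · rw [hvan α hα v hv, h0 v b (by simp [hv]), h0 v d (by simp [hv])]
          ring
      refine ⟨-(α d / w b d), -(α b / w d b), fun a _ => ?_⟩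
      have := congrArg (fun g : (Fin k → F) →ₗ[F] F => g a) heq
      simp only [LinearMap.add_apply, LinearMap.smul_apply, smul_eq_mul, hφ, hψ] at this
      rw [this, hanti a b, hanti a d]
      ring)
  rw [← mul_zero c, ← key, Finset.mul_sum]
  refine Finset.sum_congr rfl fun a ha => ?_
  obtain ⟨haU, haY⟩ := Finset.mem_sdiff.1 ha
  have hperm : (insert a Y).toList.Perm (a :: Y.toList) := Finset.toList_insert haY
  have := listWeight_perm hf (U := U) hperm [] (by
      rw [List.nil_append, hperm.length_eq]; simp; omega)
    (by simpa using Finset.nodup_toList _)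
    (by
      rw [List.nil_append, Finset.toList_toFinset]
      exact Finset.insert_subset haU hY) (by omega)
  simp only [List.nil_append] at this
  rw [this, listWeight, hc a (hU haU) (by simpa using haY), hTp, mul_assoc]
  congr 3
  ext v
  simp only [List.toFinset_cons, Finset.toList_toFinset, Finset.mem_sdiff, Finset.mem_insert,
    Finset.mem_erase]
  tauto

lemma length_subseq_of_subset {α : Type} {d : α} {L : List α} {s : Finset ℕ}
    (hs : s ⊆ Finset.range L.length) : (subseq d L s).length = s.card := by
  rw [length_subseq, Finset.filter_mem_eq_inter, Finset.inter_eq_right.2 hs]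

lemma length_subseqC_add {α : Type} {d : α} {L : List α} {s : Finset ℕ}
    (hs : s ⊆ Finset.range L.length) : (subseqC d L s).length + s.card = L.length := by
  rw [← length_subseq_of_subset (d := d) hs, ← List.length_append,
    (subseqC_append_subseq_perm d L s).length_eq]

lemma getD_mem_subseqC_iff {α : Type} {d : α} {L : List α} (hL : L.Nodup) {s : Finset ℕ} {i : ℕ}
    (hi : i < L.length) : L.getD i d ∈ subseqC d L s ↔ i ∉ s := by
  rw [mem_subseqC]
  constructor
  · rintro ⟨j, hj, hjs, h⟩
    rw [List.getD_eq_getElem _ _ hj, List.getD_eq_getElem _ _ hi,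
      List.Nodup.getElem_inj_iff hL] at h
    exact h ▸ hjs
  · exact fun h => ⟨i, hi, h, rfl⟩

lemma toFinset_sdiff_of_perm {α : Type*} [DecidableEq α] {l l₁ l₂ : List α} (hl : l.Nodup)
    (h : l.Perm (l₁ ++ l₂)) : l.toFinset \ l₁.toFinset = l₂.toFinset := by
  have hd := List.disjoint_of_nodup_append (h.nodup_iff.1 hl)
  ext a
  simp only [Finset.mem_sdiff, List.mem_toFinset, h.mem_iff, List.mem_append]
  exact ⟨fun h => h.1.resolve_left h.2, fun h => ⟨Or.inr h, fun h' => hd h' h⟩⟩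

lemma sum_powersetCard_filter_eq_sum_subseqC {α : Type} {F : Type*} [DecidableEq α]
    [AddCommMonoid F] (d : α) {L : List α} (hL : L.Nodup) (U V W : Finset α)
    (hU : U = V ∪ W ∪ L.toFinset) (hVL : Disjoint V L.toFinset) (hWL : Disjoint W L.toFinset)
    (hVW : Disjoint V W) (G : Finset α → F) {r b : ℕ} (hr : r + b = V.card + L.length) :
    ∑ C ∈ U.powersetCard r with V ⊆ C ∧ Disjoint W C, G C =
      ∑ s ∈ (Finset.range L.length).powersetCard b, G (V ∪ (subseqC d L s).toFinset) := by
  have hsub : ∀ s, (subseqC d L s).toFinset ⊆ L.toFinset := by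
    intro s a ha
    rw [List.mem_toFinset] at ha ⊢
    exact (subseqC_append_subseq_perm d L s).mem_iff.1 (List.mem_append_left _ ha)
  have hLmem : ∀ i < L.length, L.getD i d ∈ L.toFinset := by
    intro i hi
    rw [List.getD_eq_getElem _ _ hi]
    simp
  have hcard : ∀ s ∈ (Finset.range L.length).powersetCard b,
      (V ∪ (subseqC d L s).toFinset).card = r := by
    intro s hs
    rw [Finset.mem_powersetCard] at hs
    rw [Finset.card_union_of_disjoint (hVL.mono_right (hsub s)), List.toFinset_card_of_nodup
      (List.Nodup.of_append_left ((subseqC_append_subseq_perm d L s).nodup_iff.2 hL))]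
    have := length_subseqC_add (d := d) hs.1
    omega
  have hinv : ∀ C, C ∈ U.powersetCard r → V ⊆ C → Disjoint W C →
      V ∪ (subseqC d L ((Finset.range L.length).filter fun i => L.getD i d ∉ C)).toFinset = C := by
    intro C hC hVC hWC
    rw [Finset.mem_powersetCard] at hC
    ext a
    simp only [Finset.mem_union, List.mem_toFinset, mem_subseqC, Finset.mem_filter,
      Finset.mem_range, not_and, not_not]
    constructor
    · rintro (h | ⟨i, hi, h, rfl⟩)
      · exact hVC h
      · exact h hi
    · intro ha
      have haU := hC.1 ha
      rw [hU, Finset.mem_union, Finset.mem_union] at haU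
      rcases haU with (h | h) | h
      · exact Or.inl h
      · exact absurd ha (Finset.disjoint_left.1 hWC h)
      · obtain ⟨i, hi, rfl⟩ := List.mem_iff_getElem.1 (List.mem_toFinset.1 h)
        exact Or.inr ⟨i, hi, fun _ => by rwa [List.getD_eq_getElem _ _ hi],
          List.getD_eq_getElem _ _ hi⟩
  symm
  refine Finset.sum_bij' (fun s _ => V ∪ (subseqC d L s).toFinset)
    (fun C _ => (Finset.range L.length).filter fun i => L.getD i d ∉ C) ?_ ?_ ?_ ?_ ?_
  · intro s hs
    rw [Finset.mem_filter, Finset.mem_powersetCard]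
    refine ⟨⟨?_, hcard s hs⟩, Finset.subset_union_left, ?_⟩
    · rw [hU]
      exact Finset.union_subset_union Finset.subset_union_left (hsub s)
    · exact Finset.disjoint_union_right.2 ⟨hVW.symm, hWL.mono_right (hsub s)⟩
  · intro C hC
    rw [Finset.mem_filter] at hC
    rw [Finset.mem_powersetCard]
    refine ⟨Finset.filter_subset _ _, ?_⟩
    have h1 := hinv C hC.1 hC.2.1 hC.2.2
    have h2 := congrArg Finset.card h1
    rw [(Finset.mem_powersetCard.1 hC.1).2,
      Finset.card_union_of_disjoint (hVL.mono_right (hsub _)), List.toFinset_card_of_nodup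
      (List.Nodup.of_append_left ((subseqC_append_subseq_perm d L _).nodup_iff.2 hL))] at h2
    have := length_subseqC_add (d := d) (Finset.filter_subset (fun i => L.getD i d ∉ C)
      (Finset.range L.length))
    omega
  · intro s hs
    rw [Finset.mem_powersetCard] at hs
    ext i
    simp only [Finset.mem_filter, Finset.mem_range, Finset.mem_union, List.mem_toFinset, not_or]
    constructor
    · rintro ⟨hi, -, h⟩
      rwa [getD_mem_subseqC_iff hL hi, not_not] at h
    · intro his
      have hi := Finset.mem_range.1 (hs.1 his)
      exact ⟨hi, fun h => Finset.disjoint_left.1 hVL h (hLmem i hi),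
        by rwa [getD_mem_subseqC_iff hL hi, not_not]⟩
  · intro C hC
    rw [Finset.mem_filter] at hC
    exact hinv C hC.1 hC.2.1 hC.2.2
  · exact fun _ _ => rfl

lemma prod_indicator_sub_eq_sum {F : Type*} [Field F] (P Q : ℕ → Prop) [DecidablePred P]
    [DecidablePred Q] (M : Finset ℕ) :
    ∏ i ∈ M, ((if P i then (1 : F) else 0) - (if Q i then 1 else 0)) =
      ∑ τ ∈ M.powerset, (-1) ^ τ.card *
        if (∀ i ∈ τ, ¬ P i ∧ Q i) ∧ ∀ i ∈ M \ τ, P i ∧ ¬ Q i then 1 else 0 := by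
  have h : ∀ i, (if P i then (1 : F) else 0) - (if Q i then 1 else 0) =
      -1 * (if ¬ P i ∧ Q i then 1 else 0) + (if P i ∧ ¬ Q i then 1 else 0) := by
    intro i
    by_cases hP : P i <;> by_cases hQ : Q i <;> simp [hP, hQ]
  simp only [h]
  rw [Finset.prod_add]
  refine Finset.sum_congr rfl fun τ _ => ?_
  rw [Finset.prod_mul_distrib, Finset.prod_const, Finset.prod_boole, Finset.prod_boole,
    ite_and, mul_assoc, ite_mul, one_mul, zero_mul]

lemma perm_append_subseq {α : Type} (d : α) (A L Om X Y : List α) (s τ : Finset ℕ) :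
    (A ++ L ++ Om ++ X ++ Y).Perm ((A ++ subseqC d X τ ++ subseq d Y τ ++ subseqC d L s) ++
      (Om ++ subseq d L s ++ subseq d X τ ++ subseqC d Y τ)) := by
  classical
  rw [List.perm_iff_count]
  intro a
  have h1 := (subseqC_append_subseq_perm d L s).count_eq a
  have h2 := (subseqC_append_subseq_perm d X τ).count_eq a
  have h3 := (subseqC_append_subseq_perm d Y τ).count_eq a
  simp only [List.count_append] at h1 h2 h3 ⊢
  omega

/-- Expansion of a sum weighted by products of differences of indicators. -/
lemma sum_indicator_eq_sum_subseq {α : Type} {F : Type*} [DecidableEq α] [Field F] (d : α)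
    (A L Om X Y : List α) (hnd : (A ++ L ++ Om ++ X ++ Y).Nodup) {m b r : ℕ}
    (hX : X.length = m) (hY : Y.length = m)
    (hr : r + b = A.length + m + L.length) (G : Finset α → F) :
    ∑ C ∈ (A ++ L ++ Om ++ X ++ Y).toFinset.powersetCard r,
      G C * ((if A.toFinset ⊆ C then 1 else 0) * (if Disjoint Om.toFinset C then 1 else 0) *
        ∏ i ∈ Finset.range m,
          ((if X.getD i d ∈ C then 1 else 0) - (if Y.getD i d ∈ C then 1 else 0))) =
    ∑ s ∈ (Finset.range L.length).powersetCard b, ∑ τ ∈ (Finset.range m).powerset,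
      (-1) ^ τ.card *
        G (A ++ subseqC d X τ ++ subseq d Y τ ++ subseqC d L s).toFinset := by
  rw [Finset.sum_comm]
  simp only [prod_indicator_sub_eq_sum, Finset.mul_sum]
  rw [Finset.sum_comm]
  refine Finset.sum_congr rfl fun τ hτ => ?_
  rw [Finset.mem_powerset] at hτ
  have hperm := perm_append_subseq d A L Om X Y ∅ τ
  have hL0 : subseqC d L ∅ = L := by
    have h := (subseqC_append_subseq_perm d L ∅)
    refine List.ext_getElem ?_ ?_
    · have := length_subseqC_add (d := d) (L := L) (Finset.empty_subset _)
      simpa using this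
    · intro i h1 h2
      simp only [subseqC]
      simp [h2]
  have hL0' : subseq d L ∅ = [] := by simp [subseq]
  rw [hL0, hL0'] at hperm
  have hnd' := hperm.nodup_iff.1 hnd
  set Vl := A ++ subseqC d X τ ++ subseq d Y τ with hVl
  set Wl := Om ++ [] ++ subseq d X τ ++ subseqC d Y τ with hWl
  have hVn : Vl.Nodup := hnd'.of_append_left.of_append_left
  have hLn : L.Nodup := hnd'.of_append_left.of_append_right
  have dVL : Disjoint Vl.toFinset L.toFinset :=
    List.disjoint_toFinset_iff_disjoint.2 (List.disjoint_of_nodup_append hnd'.of_append_left)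
  have dVLW := List.disjoint_append_left.1 (List.disjoint_of_nodup_append hnd')
  have hVlen : Vl.length = A.length + m := by
    have h1 := length_subseqC_add (d := d) (L := X) (hX ▸ hτ)
    have h2 := length_subseq_of_subset (d := d) (L := Y) (hY ▸ hτ)
    simp only [hVl, List.length_append]
    omega
  have key := sum_powersetCard_filter_eq_sum_subseqC d hLn (A ++ L ++ Om ++ X ++ Y).toFinset
    Vl.toFinset Wl.toFinset
    (by rw [List.toFinset_eq_of_perm _ _ hperm]; ext a; simp; tauto) dVL
    (List.disjoint_toFinset_iff_disjoint.2 dVLW.2.symm)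
    (List.disjoint_toFinset_iff_disjoint.2 dVLW.1) G (r := r) (b := b)
    (by rw [List.toFinset_card_of_nodup hVn, hVlen, hr])
  simp only [List.toFinset_append (l := Vl), ← Finset.mul_sum]
  rw [← key, Finset.mul_sum, Finset.sum_filter]
  refine Finset.sum_congr rfl fun C _ => ?_
  have hiff : (Vl.toFinset ⊆ C ∧ Disjoint Wl.toFinset C) ↔
      (A.toFinset ⊆ C ∧ Disjoint Om.toFinset C) ∧
      ((∀ i ∈ τ, X.getD i d ∉ C ∧ Y.getD i d ∈ C) ∧
        ∀ i ∈ Finset.range m \ τ, X.getD i d ∈ C ∧ Y.getD i d ∉ C) := by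
    have hmem : ∀ i ∈ τ, i < m := fun i hi => Finset.mem_range.1 (hτ hi)
    simp only [hVl, hWl, Finset.disjoint_left, Finset.subset_iff, List.mem_toFinset,
      List.mem_append, mem_subseq, mem_subseqC, hX, hY, Finset.mem_sdiff, Finset.mem_range]
    constructor
    · rintro ⟨h1, h2⟩
      exact ⟨⟨fun a ha => h1 (Or.inl (Or.inl ha)), fun a ha => h2 (by simp [ha])⟩,
        fun i hi => ⟨h2 (Or.inl (Or.inr ⟨i, hmem i hi, hi, rfl⟩)),
          h1 (Or.inr ⟨i, hmem i hi, hi, rfl⟩)⟩,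
        fun i hi => ⟨h1 (Or.inl (Or.inr ⟨i, hi.1, hi.2, rfl⟩)),
          h2 (Or.inr ⟨i, hi.1, hi.2, rfl⟩)⟩⟩
    · rintro ⟨⟨h1, h2⟩, h3, h4⟩
      refine ⟨?_, ?_⟩
      · rintro a ((ha | ⟨i, hi, hiτ, rfl⟩) | ⟨i, hi, hiτ, rfl⟩)
        exacts [h1 ha, (h4 i ⟨hi, hiτ⟩).1, (h3 i hiτ).2]
      · rintro a (((ha | ha) | ⟨i, hi, hiτ, rfl⟩) | ⟨i, hi, hiτ, rfl⟩)
        exacts [h2 ha, absurd ha (by simp), (h3 i hiτ).1, (h4 i ⟨hi, hiτ⟩).2]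
  simp only [hiff]
  split_ifs <;> simp_all
  ring

/-- The signed Segre product in terms of an alternating function representing the tangent
functions. -/
lemma pow_mul_segreP_eq {F : Type} [Field F] [DecidableEq F] {k r m b : ℕ} {ε : F}
    (hε : ε * ε = 1)
    (V : Finset (Fin k → F)) (T : Finset (Fin k → F) → (Fin k → F) → F)
    (f : List (Fin k → F) → F) (hf : IsAlternating ε f)
    (hf0 : ∀ l : List (Fin k → F), l.Nodup → l.toFinset ⊆ V → l.length = r + 1 → f l ≠ 0)
    (hfT : ∀ l : List (Fin k → F), l.Nodup → l.toFinset ⊆ V → l.length = r →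
        ∃ c : F, c ≠ 0 ∧ ∀ x ∈ V, x ∉ l → f (x :: l) = c * T l.toFinset x)
    (A L Om X Y : List (Fin k → F)) (hnd : (A ++ L ++ Om ++ X ++ Y).Nodup)
    (hV : (A ++ L ++ Om ++ X ++ Y).toFinset ⊆ V) (hX : X.length = m) (hY : Y.length = m)
    (hAb : A.length = b) (hL : L.length + m = r + 1) {s τ : Finset ℕ}
    (hs : s ⊆ Finset.range L.length) (hsb : s.card = b) (hτ : τ ⊆ Finset.range m) :
    ε ^ invCount s L.length * ε ^ invCount τ m *
      segreP T ((subseqC 0 L s).toFinset ∪ (subseqC 0 X τ).toFinset)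
        (A ++ subseq 0 Y τ) (subseq 0 L s ++ subseq 0 X τ) =
      (ε ^ (b * (r + 1 - b)) * f (X ++ L))⁻¹ *
        f (A ++ subseqC 0 X τ ++ subseq 0 Y τ ++ subseqC 0 L s) := by
  have hε0 : ε ≠ 0 := fun h => by simp [h] at hε
  have hperm := perm_append_subseq 0 A L Om X Y s τ
  set Xt := subseq 0 X τ with hXt
  set Xc := subseqC 0 X τ with hXc
  set Yt := subseq 0 Y τ with hYt
  set Yc := subseqC 0 Y τ with hYc
  set B := subseq 0 L s with hB
  set Lc := subseqC 0 L s with hLc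
  have lXt : Xt.length = τ.card := length_subseq_of_subset (hX ▸ hτ)
  have lYt : Yt.length = τ.card := length_subseq_of_subset (hY ▸ hτ)
  have lB : B.length = b := by rw [hB, length_subseq_of_subset hs, hsb]
  have lXc : Xc.length + τ.card = m := by
    rw [← hX]; exact length_subseqC_add (hX ▸ hτ)
  have lLc : Lc.length + b = L.length := by
    rw [← hsb]; exact length_subseqC_add hs
  have hperm2 : (A ++ L ++ Om ++ X ++ Y).Perm
      ((A ++ Yt ++ (B ++ Xt) ++ (Xc ++ Lc)) ++ (Om ++ Yc)) := by
    refine hperm.trans ?_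
    rw [List.perm_iff_count]
    intro a
    simp only [List.count_append]
    omega
  have hn2 := (hperm2.nodup_iff.1 hnd).of_append_left
  have hV2 : (A ++ Yt ++ (B ++ Xt) ++ (Xc ++ Lc)).toFinset ⊆ V := by
    refine subset_trans ?_ hV
    rw [List.toFinset_eq_of_perm _ _ hperm2, List.toFinset_append (l' := Om ++ Yc)]
    exact Finset.subset_union_left
  have hseg := segreP_eq_div hε V T f hf hf0 hfT (A ++ Yt) (B ++ Xt) (Xc ++ Lc) hn2 hV2
    (by simp only [List.length_append]; omega) (by simp only [List.length_append]; omega)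
  rw [List.toFinset_append, Finset.union_comm] at hseg
  rw [hseg]
  have e1 := hf.swap_blocks Yt Xc Lc A
  have e2 := hf.swap_blocks Xt Xc Lc B
  have e3 := hf.subseq_move 0 B τ X Lc
  have e4 := hf.swap_blocks B (X ++ Lc) [] []
  have e5 := hf.subseq_move 0 X s L []
  rw [← hXt, ← hXc] at e3
  rw [← hB, ← hLc] at e5
  simp only [List.append_nil, List.nil_append, List.append_assoc] at e1 e2 e3 e4 e5 ⊢
  have lXL : (X ++ Lc).length = r + 1 - b := by rw [List.length_append]; omega
  rw [lXL, lB] at e4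
  rw [e1, e2, e3, e4, e5, lXt, lYt, hX]
  have hfXL : f (X ++ L) ≠ 0 := by
    refine hf0 _ ?_ ?_ (by rw [List.length_append]; omega)
    · have hp : (A ++ L ++ Om ++ X ++ Y).Perm ((X ++ L) ++ (A ++ Om ++ Y)) := by
        rw [List.perm_iff_count]
        intro a
        simp only [List.count_append]
        omega
      exact (hp.nodup_iff.1 hnd).of_append_left
    · refine subset_trans (fun a ha => ?_) hV
      simp only [List.mem_toFinset, List.mem_append] at ha ⊢
      tauto
  have hsq : ∀ j : ℕ, ε ^ j * ε ^ j = 1 := fun j => by rw [← mul_pow, hε, one_pow]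
  field_simp

/-- suppose `|S| = q + 2` (so `t = k − 3`) and `m ≤ n`, `n ≥ k − p`.  For
pairwise disjoint ordered subsequences `A` (size `n − m`), `L` (size `k − 1 − m`), `Ω`
(size `k − 2 − n`), `X = (x_1,…,x_m)`, `Y = (y_1,…,y_m)` of `S`, with `M = {1,…,m}`:
`0 = ∑_{B ⊆ L, |B| = n−m} ∑_{τ ⊆ M} (−1)^{σ(B,L)+σ(X_τ,X)+|τ|}
  P_{(L∖B)∪X_{M∖τ}}(A ⌢ Y_τ, B ⌢ X_τ)
  ∏_{z ∈ Ω∪B∪X_τ∪Y_{M∖τ}} det(z, A, X_{M∖τ}, Y_τ, L∖B)⁻¹`. -/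
theorem statement10 (p h k q t m n : ℕ) (hp : p.Prime) (hh : 1 ≤ h) (hq : q = p ^ h)
    (hk : 4 ≤ k)
    (F : Type) [Field F] [Fintype F] [DecidableEq F] (hF : Fintype.card F = q)
    (S : Finset (Fin k → F))
    (harc : ∀ A ⊆ S, A.card = k →
      LinearIndependent F (fun v : {x // x ∈ A} => (v : Fin k → F)) ∧
      Submodule.span F (A : Set (Fin k → F)) = ⊤)
    (ht : S.card + t = q + k - 1) (ht1 : 1 ≤ t) (hSk : k ≤ S.card)
    (T : Finset (Fin k → F) → (Fin k → F) → F) (hT : IsTangentFamily t S T)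
    (hS2 : S.card = q + 2)
    (hmn : m ≤ n) (hnp : k ≤ n + p)
    (A L Om X Y : List (Fin k → F))
    (hA : A.length + m = n) (hL : L.length + m + 1 = k) (hOm : Om.length + n + 2 = k)
    (hX : X.length = m) (hY : Y.length = m)
    (hnd : (A ++ L ++ Om ++ X ++ Y).Nodup)
    (hin : ∀ v ∈ A ++ L ++ Om ++ X ++ Y, v ∈ S) :
    0 = ∑ s ∈ Finset.powersetCard (n - m) (Finset.range L.length),
        ∑ tau ∈ (Finset.range m).powerset,
          (-1 : F) ^ ((t + 1) * invCount s L.length + (t + 1) * invCount tau m + tau.card) *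
            segreP T ((subseqC 0 L s).toFinset ∪ (subseqC 0 X tau).toFinset)
              (A ++ subseq 0 Y tau) (subseq 0 L s ++ subseq 0 X tau) *
            ∏ z ∈ Om.toFinset ∪ (subseq 0 L s).toFinset ∪ (subseq 0 X tau).toFinset ∪
                (subseqC 0 Y tau).toFinset,
              (detCols (z :: (A ++ subseqC 0 X tau ++ subseq 0 Y tau ++ subseqC 0 L s)))⁻¹ := by
  have htk : t + 3 = k := by omega
  have ht' : S.card + t + 1 = Fintype.card F + k := by omega
  have hε : ((-1 : F) ^ (t + 1)) * (-1) ^ (t + 1) = 1 := by rw [← mul_pow]; simp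
  obtain ⟨f, hf, -, hf0, hfT⟩ := exists_alternating (t + 1) hε S T
    (fun Y hY hYc x hx hxY => by
      obtain ⟨Φ, -, -, -, hne, hTp⟩ := hT Y hY (by omega)
      rw [hTp]
      exact Finset.prod_ne_zero_iff.2 fun α hα => hne α hα x hx hxY)
    (fun D hD hDc x hx y hy z hz =>
      tangent_cyclic harc ht' hT D hD (by omega) x y z hx hy hz)
  set U := (A ++ L ++ Om ++ X ++ Y).toFinset with hU
  have hUS : U ⊆ S := fun v hv => hin v (List.mem_toFinset.1 hv)
  have hUc : U.card + 3 = 2 * k := by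
    rw [hU, List.toFinset_card_of_nodup hnd]
    simp only [List.length_append]
    omega
  have hinv : ∀ j : ℕ, 1 ≤ j → j + n ≤ k - 1 → (j : F) ≠ 0 := by
    have : Fact p.Prime := ⟨hp⟩
    have : CharP F p := charP_of_card_eq_prime_pow (hF.trans hq)
    intro j h1 h2 h3
    have := Nat.le_of_dvd (by omega) ((CharP.cast_eq_zero_iff F p j).1 h3)
    omega
  have hdis : ∀ l₁ l₂ : List (Fin k → F), (l₁ ++ l₂).Nodup → ∀ a ∈ l₁, a ∉ l₂ :=
    fun l₁ l₂ h a h1 h2 => List.disjoint_of_nodup_append h h1 h2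
  have hXm : ∀ i < m, X.getD i 0 ∈ X := fun i hi => by
    rw [List.getD_eq_getElem _ _ (hX ▸ hi)]; exact List.getElem_mem _
  have hYm : ∀ i < m, Y.getD i 0 ∈ Y := fun i hi => by
    rw [List.getD_eq_getElem _ _ (hY ▸ hi)]; exact List.getElem_mem _
  have hdY := hdis _ _ hnd
  have hdX := hdis _ _ hnd.of_append_left
  have hdO := hdis _ _ hnd.of_append_left.of_append_left
  have hXn : X.Nodup := hnd.of_append_left.of_append_right
  have hYn : Y.Nodup := hnd.of_append_right
  have key := sum_indicator_eq_zero U (fun C => listWeight f U C.toList) (k - 1) n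
    (fun Y hY hYc => sum_listWeight_insert_eq_zero harc hT htk hf hfT hUS hUc Y hY (by omega))
    hinv (fun i => X.getD i 0) (fun i => Y.getD i 0) (Finset.range m)
    (by
      intro i hi j hj hij
      rw [Finset.mem_range] at hi hj
      refine ⟨fun h => hij ?_, fun h => hij ?_, fun h => hdY _ ?_ (h ▸ hYm j hj)⟩
      · rwa [List.getD_eq_getElem _ _ (hX ▸ hi), List.getD_eq_getElem _ _ (hX ▸ hj),
          hXn.getElem_inj_iff] at h
      · rwa [List.getD_eq_getElem _ _ (hY ▸ hi), List.getD_eq_getElem _ _ (hY ▸ hj),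
          hYn.getElem_inj_iff] at h
      · exact List.mem_append_right _ (hXm i hi))
    (by
      intro i hi
      rw [Finset.mem_range] at hi
      exact ⟨List.mem_toFinset.2 (List.mem_append_left _ (List.mem_append_right _ (hXm i hi))),
        List.mem_toFinset.2 (List.mem_append_right _ (hYm i hi))⟩)
    Om.toFinset A.toFinset
    (fun a ha => by
      rw [List.mem_toFinset] at ha
      exact List.mem_toFinset.2 (by simp only [List.mem_append]; tauto))
    (fun a ha => by
      rw [List.mem_toFinset] at ha
      exact List.mem_toFinset.2 (by simp only [List.mem_append]; tauto))
    (List.disjoint_toFinset_iff_disjoint.2 fun a ha => hdO a (List.mem_append_left _ ha))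
    (by
      intro i hi
      rw [Finset.mem_range] at hi
      simp only [List.mem_toFinset]
      refine ⟨fun h => hdX _ ?_ (hXm i hi), fun h => hdY _ ?_ (hYm i hi),
        fun h => hdX _ ?_ (hXm i hi), fun h => hdY _ ?_ (hYm i hi)⟩ <;>
      simp only [List.mem_append] <;> tauto)
    (by
      rw [Finset.card_range, List.toFinset_card_of_nodup
        hnd.of_append_left.of_append_left.of_append_left.of_append_left]
      omega)
    (by
      rw [Finset.card_range, List.toFinset_card_of_nodup
        hnd.of_append_left.of_append_left.of_append_left.of_append_left,
        List.toFinset_card_of_nodup hnd.of_append_left.of_append_left.of_append_right]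
      omega)
  rw [hU, sum_indicator_eq_sum_subseq 0 A L Om X Y hnd hX hY (b := n - m) (by omega), ← hU] at key
  rw [← mul_zero ((((-1 : F) ^ (t + 1)) ^ ((n - m) * (t + 1 + 1 - (n - m))) * f (X ++ L))⁻¹),
    ← key, Finset.mul_sum]
  refine Finset.sum_congr rfl fun s hs => ?_
  rw [Finset.mem_powersetCard] at hs
  rw [Finset.mul_sum]
  refine Finset.sum_congr rfl fun τ hτ => ?_
  rw [Finset.mem_powerset] at hτ
  have hseg := pow_mul_segreP_eq hε S T f hf hf0 hfT A L Om X Y hnd hUS hX hY (b := n - m)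
    (by omega) (by omega) hs.1 hs.2 hτ
  have hperm := perm_append_subseq 0 A L Om X Y s τ
  have hsd := toFinset_sdiff_of_perm hnd hperm
  have hC0 := (hperm.nodup_iff.1 hnd).of_append_left
  have hC0U : (A ++ subseqC 0 X τ ++ subseq 0 Y τ ++ subseqC 0 L s).toFinset ⊆ U := by
    rw [hU, List.toFinset_eq_of_perm _ _ hperm, List.toFinset_append (l' := Om ++ _ ++ _ ++ _)]
    exact Finset.subset_union_left
  have hC0l : (A ++ subseqC 0 X τ ++ subseq 0 Y τ ++ subseqC 0 L s).length + 1 = k := by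
    have h1 := length_subseq_of_subset (d := 0) (L := Y) (hY ▸ hτ)
    have h2 := length_subseqC_add (d := 0) (L := X) (hX ▸ hτ)
    have h3 := length_subseqC_add (d := 0) (L := L) hs.1
    simp only [List.length_append]
    omega
  set C₀ := A ++ subseqC 0 X τ ++ subseq 0 Y τ ++ subseqC 0 L s with hC₀
  have hw := listWeight_perm hf (U := U) (List.toFinset_toList hC0).symm [] hC0l hC0 hC0U
    (by omega)
  simp only [List.nil_append] at hw
  rw [← hw, listWeight, hsd]
  simp only [List.toFinset_append]
  have hpow : (-1 : F) ^ ((t + 1) * invCount s L.length + (t + 1) * invCount τ m + τ.card) =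
      ((-1) ^ (t + 1)) ^ invCount s L.length * ((-1) ^ (t + 1)) ^ invCount τ m *
        (-1) ^ τ.card := by
    rw [pow_add, pow_add, pow_mul, pow_mul]
  rw [hpow]
  linear_combination -((-1) ^ τ.card * ∏ z ∈ Om.toFinset ∪ (subseq 0 L s).toFinset ∪
    (subseq 0 X τ).toFinset ∪ (subseqC 0 Y τ).toFinset, (detCols (z :: C₀))⁻¹) * hseg
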